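/- arXiv:1112.2554 — 3 statements merged into one kernel-verified Lean document; each statement's English description precedes it below -/
import Mathlib

section
/- Let l > n ≥ 1 be integers, and for an integer r with 0 ≤ r ≤ l − n define T(l,n;r) = Σ_{l₁,…,l_n≥1, l₁+⋯+l_n=l−r} C(l₁+r−1, r) ζ(l₁+r, l₂,…,l_n), where C(·,·) is the binomial coefficient and ζ(1, l₂,…,l_n) is interpreted as 0. Then for every integer r with 1 ≤ r ≤ l − n − 1, T(l,n;r) + (−1)^n T(l,n; l−n−r) = Σ_{j₁,j₂≥1, j₁+j₂=n} (−1)^{j₂−1} ζ(r+1,{1}^{j₁−1}) ζ(l−n−r+1,{1}^{j₂−1}). -/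
open scoped BigOperators

/-- The multiple zeta value `ζ(l₁, …, lₙ)`, as a sum over strictly decreasing
tuples of positive integers. -/
noncomputable def mzv {n : ℕ} (l : Fin n → ℕ) : ℝ :=
  ∑' m : {m : Fin n → ℕ // StrictAnti m ∧ ∀ i, 0 < m i},
    ∏ i, ((m.1 i : ℝ) ^ (l i))⁻¹

/-- The Riemann zeta value `ζ(k)`. -/
noncomputable def rz (k : ℕ) : ℝ := ∑' m : ℕ+, ((m : ℝ) ^ k)⁻¹


/-- `T(l,n;r) = Σ_{l₁,…,lₙ≥1, l₁+⋯+lₙ=l-r} C(l₁+r-1, r) ζ(l₁+r, l₂,…,lₙ)`.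
(When `l₁ + r = 1` the series defining `ζ(1, l₂, …, lₙ)` diverges and the `tsum`
in `mzv` is `0`, matching the convention `ζ(1, l₂, …, lₙ) = 0`.) -/
noncomputable def T (l n r : ℕ) : ℝ :=
  match n with
  | 0 => 0
  | k + 1 =>
    ∑ c ∈ (Finset.Nat.antidiagonalTuple (k + 1) (l - r)).filter (fun c => ∀ i, 1 ≤ c i),
      ((c 0 + r - 1).choose r : ℝ) * mzv (fun i => if i = 0 then c 0 + r else c i)

open MeasureTheory Set Filter Topology
open scoped ENNReal

/-- The truncated multiple zeta value: the sum over strictly decreasing tuples with entries in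
`{1, …, M}`. -/
noncomputable def truncatedMzv : {n : ℕ} → (Fin n → ℕ) → ℕ → ℝ≥0∞
  | 0, _, _ => 1
  | _ + 1, l, M =>
    ∑ m ∈ Finset.range M, (((m : ℝ≥0∞) + 1) ^ l 0)⁻¹ * truncatedMzv (Fin.tail l) m

/-- The extended nonnegative real value of the multiple zeta series. -/
noncomputable def mzvENN {n : ℕ} (l : Fin (n + 1) → ℕ) : ℝ≥0∞ :=
  ∑' m : ℕ, (((m : ℝ≥0∞) + 1) ^ l 0)⁻¹ * truncatedMzv (Fin.tail l) m

/-- The strictly decreasing tuples of positive integers with entries in `U`. -/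
def decreasingTuples (n : ℕ) (U : Set ℕ) : Set (Fin n → ℕ) :=
  {m | StrictAnti m ∧ ∀ i, 0 < m i ∧ m i ∈ U}

lemma cons_mem_decreasingTuples {n : ℕ} {U : Set ℕ} (hU : IsLowerSet U) (a : ℕ)
    (x : Fin n → ℕ) :
    (Fin.cons (a + 1) x : Fin (n + 1) → ℕ) ∈ decreasingTuples (n + 1) U ↔
      a + 1 ∈ U ∧ x ∈ decreasingTuples n (Set.Iic a) := by
  simp only [decreasingTuples, mem_ofPred_eq, Fin.forall_fin_succ, Fin.cons_zero, Fin.cons_succ,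
    mem_Iic]
  constructor
  · rintro ⟨h, ⟨-, h0⟩, h1⟩
    refine ⟨h0, fun i j hij => ?_, fun i => ⟨(h1 i).1, ?_⟩⟩
    · simpa using h (Fin.succ_lt_succ_iff.mpr hij)
    · have := h (Fin.succ_pos i)
      simp only [Fin.cons_zero, Fin.cons_succ] at this
      omega
  · rintro ⟨h0, h, h1⟩
    refine ⟨fun i j hij => ?_, ⟨by omega, h0⟩, fun i => ⟨(h1 i).1, hU ?_ h0⟩⟩
    · induction j using Fin.cases with
      | zero => exact absurd hij (Fin.not_lt_zero i)
      | succ j =>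
        induction i using Fin.cases with
        | zero =>
          have := (h1 j).2
          simp only [Fin.cons_zero, Fin.cons_succ]
          omega
        | succ i => simpa using h (Fin.succ_lt_succ_iff.mp hij)
    · have := (h1 i).2
      omega

lemma tsum_indicator_decreasingTuples_succ {n : ℕ} {U : Set ℕ} (hU : IsLowerSet U)
    (l : Fin (n + 1) → ℕ) :
    ∑' m, (decreasingTuples (n + 1) U).indicator (fun m => ∏ i, ((m i : ℝ≥0∞) ^ l i)⁻¹) m =
      ∑' a : ℕ, U.indicator 1 (a + 1) * ((((a : ℝ≥0∞) + 1) ^ l 0)⁻¹ *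
        ∑' m, (decreasingTuples n (Set.Iic a)).indicator
          (fun m => ∏ i, ((m i : ℝ≥0∞) ^ Fin.tail l i)⁻¹) m) := by
  classical
  rw [← (Fin.consEquiv (fun _ : Fin (n + 1) => ℕ)).tsum_eq, ENNReal.tsum_prod',
    tsum_eq_zero_add' ENNReal.summable]
  have h0 : ∀ x : Fin n → ℕ, (Fin.cons 0 x : Fin (n + 1) → ℕ) ∉ decreasingTuples (n + 1) U :=
    fun x hx => by simpa using (hx.2 0).1
  refine (congrArg₂ (· + ·) (ENNReal.tsum_eq_zero.mpr fun x =>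
    indicator_of_notMem (h0 x) _) rfl).trans ((zero_add _).trans ?_)
  refine tsum_congr fun a => ?_
  rw [← ENNReal.tsum_mul_left, ← ENNReal.tsum_mul_left]
  refine tsum_congr fun x => ?_
  change (decreasingTuples (n + 1) U).indicator _ (Fin.cons (a + 1) x : Fin (n + 1) → ℕ) = _
  simp only [indicator_apply, cons_mem_decreasingTuples hU, Fin.prod_univ_succ, Fin.cons_zero,
    Fin.cons_succ, Fin.tail, Pi.one_apply]
  by_cases h1 : a + 1 ∈ U <;> by_cases h2 : x ∈ decreasingTuples n (Set.Iic a) <;> simp [h1, h2]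

lemma tsum_indicator_decreasingTuples_Iic {n : ℕ} (l : Fin n → ℕ) (M : ℕ) :
    ∑' m, (decreasingTuples n (Set.Iic M)).indicator (fun m => ∏ i, ((m i : ℝ≥0∞) ^ l i)⁻¹) m =
      truncatedMzv l M := by
  induction n generalizing M with
  | zero =>
    rw [tsum_fintype, Fintype.sum_unique]
    have h (x : Fin 0 → ℕ) : x ∈ decreasingTuples 0 (Set.Iic M) :=
      ⟨fun i => i.elim0, fun i => i.elim0⟩
    rw [indicator_of_mem (h _)]
    simp [truncatedMzv]
  | succ n ih =>
    rw [tsum_indicator_decreasingTuples_succ (isLowerSet_Iic M), truncatedMzv,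
      tsum_eq_sum (s := Finset.range M)]
    · refine Finset.sum_congr rfl fun a ha => ?_
      rw [indicator_of_mem (by simpa [Nat.succ_le_iff] using ha), ih]
      simp
    · intro a ha
      rw [indicator_of_notMem (by simpa [Nat.succ_le_iff] using ha), zero_mul]

lemma mzv_eq_toReal {n : ℕ} (l : Fin (n + 1) → ℕ) : mzv l = (mzvENN l).toReal := by
  have h : mzvENN l = ∑' m : {m : Fin (n + 1) → ℕ // StrictAnti m ∧ ∀ i, 0 < m i},
      ∏ i, ((m.1 i : ℝ≥0∞) ^ l i)⁻¹ := by
    have h1 := tsum_subtype {m : Fin (n + 1) → ℕ | StrictAnti m ∧ ∀ i, 0 < m i}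
      (fun m => ∏ i, ((m i : ℝ≥0∞) ^ l i)⁻¹)
    have h2 : {m : Fin (n + 1) → ℕ | StrictAnti m ∧ ∀ i, 0 < m i} =
        decreasingTuples (n + 1) Set.univ := by simp [decreasingTuples]
    refine Eq.trans ?_ h1.symm
    rw [h2, tsum_indicator_decreasingTuples_succ isLowerSet_univ, mzvENN]
    simp [tsum_indicator_decreasingTuples_Iic]
  rw [h, ENNReal.tsum_toReal_eq]
  · refine tsum_congr fun m => ?_
    rw [ENNReal.toReal_prod]
    simp
  · intro m
    refine ENNReal.prod_ne_top fun i _ => ?_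
    have : (m.1 i : ℝ≥0∞) ≠ 0 := by exact_mod_cast (m.2.2 i).ne'
    simp [this]

lemma sum_antidiagonalTuple_succ {M : Type*} [AddCommMonoid M] (p c : ℕ)
    (f : (Fin (p + 1) → ℕ) → M) :
    ∑ x ∈ Finset.Nat.antidiagonalTuple (p + 1) c, f x =
      ∑ b ∈ Finset.HasAntidiagonal.antidiagonal c, ∑ x ∈ Finset.Nat.antidiagonalTuple p b.2,
        f (Fin.cons b.1 x) := by
  rw [Finset.sum_sigma']
  refine Finset.sum_nbij' (fun x => ⟨(x 0, ∑ i, Fin.tail x i), Fin.tail x⟩)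
    (fun y => Fin.cons y.1.1 y.2) ?_ ?_ ?_ ?_ ?_
  · intro x hx
    rw [Finset.Nat.mem_antidiagonalTuple, Fin.sum_univ_succ] at hx
    simpa [Finset.Nat.mem_antidiagonalTuple, Fin.tail] using hx
  · rintro ⟨⟨b, c'⟩, y⟩ hy
    simp only [Finset.mem_sigma, Finset.HasAntidiagonal.mem_antidiagonal,
      Finset.Nat.mem_antidiagonalTuple] at hy
    rw [Finset.Nat.mem_antidiagonalTuple, Fin.sum_univ_succ]
    simp [hy.1, hy.2]
  · intro x _
    exact Fin.cons_self_tail x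
  · rintro ⟨⟨b, c'⟩, y⟩ hy
    simp only [Finset.mem_sigma, Finset.HasAntidiagonal.mem_antidiagonal,
      Finset.Nat.mem_antidiagonalTuple] at hy
    obtain ⟨-, rfl⟩ := hy
    simp [Fin.tail]
  · intro x _
    simp

lemma sum_filter_one_le_antidiagonalTuple {M : Type*} [AddCommMonoid M] (p c : ℕ)
    (f : (Fin p → ℕ) → M) :
    ∑ x ∈ (Finset.Nat.antidiagonalTuple p (c + p)).filter (fun x => ∀ i, 1 ≤ x i), f x =
      ∑ x ∈ Finset.Nat.antidiagonalTuple p c, f (fun i => x i + 1) := by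
  refine Finset.sum_nbij' (fun x i => x i - 1) (fun x i => x i + 1) ?_ ?_ ?_ ?_ ?_
  · intro x hx
    simp only [Finset.mem_filter, Finset.Nat.mem_antidiagonalTuple] at hx ⊢
    have : ∑ i, x i = ∑ i, (x i - 1 + 1) :=
      Finset.sum_congr rfl fun i _ => (Nat.sub_add_cancel (hx.2 i)).symm
    rw [Finset.sum_add_distrib] at this
    simp only [Finset.sum_const, Finset.card_univ, Fintype.card_fin, smul_eq_mul, mul_one] at this
    omega
  · intro x hx
    simp only [Finset.mem_filter, Finset.Nat.mem_antidiagonalTuple] at hx ⊢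
    simp [Finset.sum_add_distrib, hx]
  · intro x hx
    simp only [Finset.mem_filter] at hx
    exact funext fun i => Nat.sub_add_cancel (hx.2 i)
  · intro x _
    simp
  · intro x hx
    simp only [Finset.mem_filter] at hx
    exact congrArg f (funext fun i => (Nat.sub_add_cancel (hx.2 i)).symm)

/-- The sum of all truncated multiple zeta values of depth `p` and weight `c + p`. -/
noncomputable def weightSum : ℕ → ℕ → ℕ → ℝ≥0∞
  | 0, c, _ => if c = 0 then 1 else 0
  | p + 1, c, M => ∑ m ∈ Finset.range M, ∑ b ∈ Finset.HasAntidiagonal.antidiagonal c,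
      (((m : ℝ≥0∞) + 1) ^ (b.1 + 1))⁻¹ * weightSum p b.2 m

lemma weightSum_eq (p c M : ℕ) :
    weightSum p c M =
      ∑ x ∈ Finset.Nat.antidiagonalTuple p c, truncatedMzv (fun i => x i + 1) M := by
  induction p generalizing c M with
  | zero => cases c <;> simp [weightSum, truncatedMzv]
  | succ p ih =>
    rw [weightSum, sum_antidiagonalTuple_succ, Finset.sum_comm]
    refine Finset.sum_congr rfl fun b _ => ?_
    simp only [truncatedMzv, Fin.cons_zero, ih, Finset.mul_sum]
    rw [Finset.sum_comm]
    rfl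

/-- The sum `T` in terms of extended nonnegative reals, with parameters `l = a + r + k + 1` and
`n = k + 1`. -/
noncomputable def TENN (k a r : ℕ) : ℝ≥0∞ :=
  ∑ b ∈ Finset.HasAntidiagonal.antidiagonal a, ((b.1 + r).choose r : ℝ≥0∞) *
    ∑' m : ℕ, (((m : ℝ≥0∞) + 1) ^ (b.1 + r + 1))⁻¹ * weightSum k b.2 m

lemma TENN_eq_sum (k a r : ℕ) :
    TENN k a r = ∑ x ∈ Finset.Nat.antidiagonalTuple (k + 1) a,
      ((x 0 + r).choose r : ℝ≥0∞) * mzvENN (fun i => if i = 0 then x 0 + 1 + r else x i + 1) := by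
  rw [sum_antidiagonalTuple_succ, TENN]
  refine Finset.sum_congr rfl fun b _ => ?_
  simp only [Fin.cons_zero, ← Finset.mul_sum, mzvENN, weightSum_eq, if_true]
  rw [← Summable.tsum_finsetSum fun _ _ => ENNReal.summable]
  congr 1
  refine tsum_congr fun m => ?_
  rw [Finset.mul_sum]
  refine Finset.sum_congr rfl fun x _ => ?_
  rw [add_right_comm b.1 1 r]
  congr 2

lemma T_eq_toReal {k a r : ℕ} (h : TENN k a r ≠ ∞) :
    T (a + r + (k + 1)) (k + 1) r = (TENN k a r).toReal := by
  rw [TENN_eq_sum] at h ⊢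
  rw [ENNReal.toReal_sum fun x hx => ne_top_of_le_ne_top h
    (Finset.single_le_sum (f := fun x : Fin (k + 1) → ℕ => ((x 0 + r).choose r : ℝ≥0∞) *
      mzvENN (fun i => if i = 0 then x 0 + 1 + r else x i + 1)) (fun _ _ => zero_le) hx)]
  have hl : a + r + (k + 1) - r = a + (k + 1) := by omega
  simp only [T]
  rw [hl, sum_filter_one_le_antidiagonalTuple]
  refine Finset.sum_congr rfl fun x _ => ?_
  rw [mzv_eq_toReal, ENNReal.toReal_mul, ENNReal.toReal_natCast]
  simp only [add_right_comm (x 0) 1 r, Nat.add_sub_cancel]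

lemma mzv_cons_one_eq_toReal (k r : ℕ) :
    mzv (Fin.cons (r + 1) (fun _ : Fin k => 1)) = (TENN k 0 r).toReal := by
  rw [mzv_eq_toReal (Fin.cons (r + 1) (fun _ : Fin k => 1) : Fin (k + 1) → ℕ), TENN_eq_sum,
    Finset.Nat.antidiagonalTuple_zero_right, Finset.sum_singleton]
  simp only [Pi.zero_apply, zero_add, Nat.choose_self, Nat.cast_one, one_mul]
  congr 2
  funext i
  induction i using Fin.cases <;> simp [add_comm]

lemma TENN_zero (a r : ℕ) :
    TENN 0 a r = ((a + r).choose r : ℝ≥0∞) * ∑' m : ℕ, (((m : ℝ≥0∞) + 1) ^ (a + r + 1))⁻¹ := by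
  rw [TENN_eq_sum, Finset.Nat.antidiagonalTuple_one, Finset.sum_singleton]
  simp [mzvENN, truncatedMzv, add_right_comm a 1 r]

lemma weightSum_zero_le (p M : ℕ) :
    weightSum p 0 (M + 1) ≤ ENNReal.ofReal (4 ^ p * √(M + 1)) := by
  induction p generalizing M with
  | zero => simp [weightSum]
  | succ p ih =>
    induction M with
    | zero =>
      have h1 := ih 0
      have h0 : weightSum p 0 0 ≤ weightSum p 0 1 := by
        cases p <;> simp [weightSum]
      simp only [weightSum, zero_add, Finset.range_one, Finset.HasAntidiagonal.antidiagonal_zero,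
        Finset.sum_singleton, Nat.cast_zero, one_pow, inv_one, one_mul]
      refine h0.trans (h1.trans (ENNReal.ofReal_le_ofReal ?_))
      gcongr <;> norm_num
    | succ M ih' =>
      have hstep : weightSum (p + 1) 0 (M + 1 + 1) =
          weightSum (p + 1) 0 (M + 1) + (((M + 1 : ℕ) : ℝ≥0∞) + 1)⁻¹ * weightSum p 0 (M + 1) := by
        rw [weightSum, Finset.sum_range_succ, ← weightSum]
        simp
      have hcast : (((M + 1 : ℕ) : ℝ≥0∞) + 1)⁻¹ = ENNReal.ofReal (((M + 1 : ℕ) + 1 : ℝ)⁻¹) := by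
        rw [ENNReal.ofReal_inv_of_pos (by positivity),
          ENNReal.ofReal_add (by positivity) zero_le_one, ENNReal.ofReal_natCast,
          ENNReal.ofReal_one]
      rw [hstep, hcast]
      refine (add_le_add ih' (mul_le_mul_right (ih M) _)).trans ?_
      rw [← ENNReal.ofReal_mul (by positivity), ← ENNReal.ofReal_add (by positivity)
        (by positivity)]
      refine ENNReal.ofReal_le_ofReal ?_
      push_cast
      set s := √((M : ℝ) + 1)
      set t := √((M : ℝ) + 1 + 1)
      have hs : s ^ 2 = (M : ℝ) + 1 := Real.sq_sqrt (by positivity)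
      have ht : t ^ 2 = (M : ℝ) + 1 + 1 := Real.sq_sqrt (by positivity)
      have hs0 : 0 < s := Real.sqrt_pos.mpr (by positivity)
      have ht0 : 0 < t := Real.sqrt_pos.mpr (by positivity)
      have hst : s ≤ t := Real.sqrt_le_sqrt (by linarith)
      have key : 4 * s + (t ^ 2)⁻¹ * s ≤ 4 * t := by
        have h1 : (t ^ 2)⁻¹ * s ≤ t⁻¹ := by
          rw [inv_mul_le_iff₀ (by positivity)]
          field_simp
          exact hst
        have h2 : t⁻¹ ≤ 4 * (t - s) := by
          rw [inv_le_iff_one_le_mul₀ ht0]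
          nlinarith
        linarith
      rw [← ht]
      calc 4 ^ (p + 1) * s + (t ^ 2)⁻¹ * (4 ^ p * s)
          = 4 ^ p * (4 * s + (t ^ 2)⁻¹ * s) := by ring
        _ ≤ 4 ^ p * (4 * t) := by gcongr
        _ = 4 ^ (p + 1) * t := by ring

lemma weightSum_mono (p c : ℕ) : Monotone (weightSum p c) := by
  intro M N h
  cases p with
  | zero => rfl
  | succ p =>
    rw [weightSum, weightSum]
    exact Finset.sum_le_sum_of_subset (Finset.range_mono h)

lemma TENN_depth_ne_top (k : ℕ) {r : ℕ} (hr : 1 ≤ r) : TENN k 0 r ≠ ∞ := by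
  have hbound : ∀ m : ℕ, (((m : ℝ≥0∞) + 1) ^ (0 + r + 1))⁻¹ * weightSum k 0 m ≤
      ENNReal.ofReal (4 ^ k * (((m + 1 : ℕ) : ℝ) ^ (3 / 2 : ℝ))⁻¹) := by
    intro m
    have hcast : (((m : ℝ≥0∞) + 1) ^ (0 + r + 1))⁻¹ ≤
        ENNReal.ofReal ((((m : ℝ) + 1) ^ 2)⁻¹) := by
      rw [ENNReal.ofReal_inv_of_pos (by positivity), ENNReal.ofReal_pow (by positivity),
        ENNReal.ofReal_add (by positivity) zero_le_one, ENNReal.ofReal_natCast,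
        ENNReal.ofReal_one]
      gcongr
      · exact le_add_self
      · omega
    refine (mul_le_mul' hcast ((weightSum_mono k 0 m.le_succ).trans
      (weightSum_zero_le k m))).trans ?_
    rw [← ENNReal.ofReal_mul (by positivity)]
    refine ENNReal.ofReal_le_ofReal (le_of_eq ?_)
    have hm : (0 : ℝ) < (m : ℝ) + 1 := by positivity
    push_cast
    rw [Real.sqrt_eq_rpow, ← Real.rpow_natCast, ← Real.rpow_neg hm.le, ← Real.rpow_neg hm.le,
      mul_left_comm, ← Real.rpow_add hm]
    norm_num
  simp only [TENN, Finset.HasAntidiagonal.antidiagonal_zero, Finset.sum_singleton,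
    zero_add, Nat.choose_self, Nat.cast_one, one_mul]
  simp only [zero_add] at hbound
  refine ne_top_of_le_ne_top ?_ (ENNReal.tsum_le_tsum hbound)
  have hsum : Summable fun m : ℕ => 4 ^ k * (((m + 1 : ℕ) : ℝ) ^ (3 / 2 : ℝ))⁻¹ :=
    ((summable_nat_add_iff 1).mpr (Real.summable_nat_rpow_inv.mpr (by norm_num))).mul_left _
  exact hsum.tsum_ofReal_ne_top

/-- The divided power `x ^ b / b!` as an extended nonnegative real. -/
noncomputable def dividedPow (b : ℕ) (x : ℝ) : ℝ≥0∞ := ENNReal.ofReal (x ^ b / b.factorial)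

@[fun_prop]
lemma measurable_dividedPow (b : ℕ) : Measurable (dividedPow b) := by
  unfold dividedPow
  fun_prop

@[simp]
lemma dividedPow_zero (x : ℝ) : dividedPow 0 x = 1 := by simp [dividedPow]

lemma dividedPow_mul (a b : ℕ) {x : ℝ} (hx : 0 ≤ x) :
    dividedPow a x * dividedPow b x = ((b + a).choose a : ℝ≥0∞) * dividedPow (b + a) x := by
  rw [dividedPow, dividedPow, dividedPow, ← ENNReal.ofReal_mul (by positivity),
    ← ENNReal.ofReal_natCast, ← ENNReal.ofReal_mul (by positivity),
    Nat.cast_choose ℝ (Nat.le_add_left a b), Nat.add_sub_cancel]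
  congr 1
  have := Nat.factorial_ne_zero (b + a)
  field_simp
  ring

lemma add_pow_div_factorial (c : ℕ) (x y : ℝ) :
    (x + y) ^ c / c.factorial = ∑ b ∈ Finset.HasAntidiagonal.antidiagonal c,
      x ^ b.1 / b.1.factorial * (y ^ b.2 / b.2.factorial) := by
  rw [(Commute.all x y).add_pow', Finset.sum_div]
  refine Finset.sum_congr rfl fun b hb => ?_
  rw [Finset.HasAntidiagonal.mem_antidiagonal] at hb
  subst hb
  rw [nsmul_eq_mul, Nat.cast_choose ℝ (Nat.le_add_right _ _), Nat.add_sub_cancel_left]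
  have := Nat.factorial_ne_zero (b.1 + b.2)
  field_simp

lemma dividedPow_add (c : ℕ) {x y : ℝ} (hx : 0 ≤ x) (hy : 0 ≤ y) :
    dividedPow c (x + y) = ∑ b ∈ Finset.HasAntidiagonal.antidiagonal c,
      dividedPow b.1 x * dividedPow b.2 y := by
  rw [dividedPow, add_pow_div_factorial, ENNReal.ofReal_sum_of_nonneg fun _ _ => by positivity]
  exact Finset.sum_congr rfl fun b _ => ENNReal.ofReal_mul (by positivity)

lemma lintegral_dividedPow_mul_exp (b m : ℕ) :
    ∫⁻ x in Ioi (0 : ℝ), dividedPow b x * ENNReal.ofReal (Real.exp (-((m + 1) * x))) =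
      (((m : ℝ≥0∞) + 1) ^ (b + 1))⁻¹ := by
  have hm : (0 : ℝ) < (m : ℝ) + 1 := by positivity
  have h := Real.integral_rpow_mul_exp_neg_mul_Ioi (a := (b : ℝ) + 1) (by positivity) hm
  have h' : ∫ x in Ioi (0 : ℝ), x ^ b / b.factorial * Real.exp (-((m + 1) * x)) =
      (((m : ℝ) + 1) ^ (b + 1))⁻¹ := by
    rw [Real.Gamma_nat_eq_factorial, add_sub_cancel_right] at h
    simp only [Real.rpow_natCast, one_div] at h
    have h2 : ∀ x : ℝ, x ^ b / b.factorial * Real.exp (-((m + 1) * x)) =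
        (x ^ b * Real.exp (-((m + 1) * x))) / b.factorial := fun x => by ring
    simp only [h2]
    rw [integral_div, h, mul_div_cancel_right₀ _ (by positivity), ← Nat.cast_succ b,
      Real.rpow_natCast, inv_pow]
  have hint : IntegrableOn (fun x : ℝ => x ^ b / b.factorial * Real.exp (-((m + 1) * x)))
      (Ioi 0) := by
    by_contra hn
    rw [integral_undef hn] at h'
    have : (0 : ℝ) < (((m : ℝ) + 1) ^ (b + 1))⁻¹ := by positivity
    exact this.ne h'
  have hnn : ∀ᵐ x ∂(volume.restrict (Ioi (0 : ℝ))),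
      0 ≤ x ^ b / b.factorial * Real.exp (-((m + 1) * x)) :=
    (ae_restrict_mem measurableSet_Ioi).mono fun x hx => by
      have : (0 : ℝ) < x := hx
      positivity
  have h3 := ofReal_integral_eq_lintegral_ofReal hint hnn
  rw [h', ENNReal.ofReal_inv_of_pos (by positivity), ENNReal.ofReal_pow hm.le,
    ENNReal.ofReal_add (by positivity) zero_le_one, ENNReal.ofReal_natCast,
    ENNReal.ofReal_one] at h3
  rw [h3]
  refine setLIntegral_congr_fun measurableSet_Ioi fun x hx => ?_
  have : (0 : ℝ) < x := hx
  exact (ENNReal.ofReal_mul (by positivity)).symm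

lemma lintegral_Ioi_shift (u : ℝ) (f : ℝ → ℝ≥0∞) :
    ∫⁻ x in Ioi u, f (x - u) = ∫⁻ x in Ioi (0 : ℝ), f x := by
  rw [← lintegral_indicator measurableSet_Ioi, ← lintegral_indicator measurableSet_Ioi,
    ← lintegral_sub_right_eq_self ((Ioi (0 : ℝ)).indicator f) u]
  refine lintegral_congr fun x => ?_
  simp [indicator_apply]

lemma lintegral_Ioi_dividedPow_mul_exp (b m : ℕ) (u : ℝ) :
    ∫⁻ x in Ioi u, dividedPow b (x - u) * ENNReal.ofReal (Real.exp (-((m + 1) * x))) =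
      ENNReal.ofReal (Real.exp (-((m + 1) * u))) * (((m : ℝ≥0∞) + 1) ^ (b + 1))⁻¹ := by
  rw [← lintegral_dividedPow_mul_exp, ← lintegral_const_mul _ (by fun_prop),
    ← lintegral_Ioi_shift u]
  refine lintegral_congr fun x => ?_
  rw [mul_left_comm, ← ENNReal.ofReal_mul (by positivity), ← Real.exp_add]
  congr 3
  ring

lemma tsum_exp_mul_tsum (u : ℝ) (w : ℕ → ℝ≥0∞) :
    (∑' k : ℕ, ENNReal.ofReal (Real.exp (-((k + 1) * u)))) *
        ∑' m : ℕ, ENNReal.ofReal (Real.exp (-((m + 1) * u))) * w m =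
      ∑' M : ℕ, ENNReal.ofReal (Real.exp (-((M + 1) * u))) * ∑ m ∈ Finset.range M, w m := by
  have h : ∀ M : ℕ, ENNReal.ofReal (Real.exp (-((M + 1) * u))) * ∑ m ∈ Finset.range M, w m =
      ∑' m : ℕ, if m < M then ENNReal.ofReal (Real.exp (-((M + 1) * u))) * w m else 0 := by
    intro M
    rw [Finset.mul_sum, tsum_eq_sum (s := Finset.range M)]
    · exact Finset.sum_congr rfl fun m hm => by rw [if_pos (Finset.mem_range.mp hm)]
    · intro m hm
      rw [if_neg (by simpa using hm)]
  rw [tsum_congr h, ENNReal.tsum_comm, ← ENNReal.tsum_mul_left]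
  refine tsum_congr fun m => ?_
  rw [← ENNReal.tsum_mul_right]
  refine Eq.trans ?_ (Summable.sum_add_tsum_nat_add' (k := m + 1) ENNReal.summable)
  rw [Finset.sum_eq_zero fun M hM => if_neg (by simpa [Nat.lt_succ_iff] using hM), zero_add]
  refine tsum_congr fun k => ?_
  rw [if_pos (by omega), ← mul_assoc, ← ENNReal.ofReal_mul (by positivity), ← Real.exp_add]
  congr 3
  push_cast
  ring

/-- The density `1 / (e ^ x - 1)` on the positive half-line. -/
noncomputable def expDensity (x : ℝ) : ℝ := (Real.exp x - 1)⁻¹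

@[fun_prop]
lemma measurable_expDensity : Measurable expDensity := by
  unfold expDensity
  fun_prop

lemma expDensity_pos {x : ℝ} (hx : 0 < x) : 0 < expDensity x :=
  inv_pos.mpr (sub_pos.mpr (Real.one_lt_exp_iff.mpr hx))

lemma ofReal_expDensity {x : ℝ} (hx : 0 < x) :
    ENNReal.ofReal (expDensity x) = ∑' m : ℕ, ENNReal.ofReal (Real.exp (-((m + 1) * x))) := by
  have h1 : Real.exp (-x) < 1 := Real.exp_lt_one_iff.mpr (by linarith)
  have h := (hasSum_geometric_of_lt_one (Real.exp_pos (-x)).le h1).mul_left (Real.exp (-x))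
  have hfun : (fun m : ℕ => Real.exp (-x) * Real.exp (-x) ^ m) =
      fun m : ℕ => Real.exp (-((m + 1) * x)) := by
    funext m
    rw [← Real.exp_nat_mul, ← Real.exp_add]
    congr 1
    ring
  rw [hfun] at h
  have hval : Real.exp (-x) * (1 - Real.exp (-x))⁻¹ = expDensity x := by
    rw [expDensity, Real.exp_neg]
    have := Real.exp_pos x
    have h2 : Real.exp x - 1 ≠ 0 := (sub_pos.mpr (Real.one_lt_exp_iff.mpr hx)).ne'
    field_simp
  rw [← hval, ← h.tsum_eq, ENNReal.ofReal_tsum_of_nonneg (fun _ => (Real.exp_pos _).le) h.summable]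

/-- The tail mass `-log (1 - e ^ (-x))` of the density `expDensity`. -/
noncomputable def tailMass (x : ℝ) : ℝ := -Real.log (1 - Real.exp (-x))

@[fun_prop]
lemma measurable_tailMass : Measurable tailMass := by
  unfold tailMass
  fun_prop

lemma hasDerivAt_tailMass {x : ℝ} (hx : 0 < x) : HasDerivAt tailMass (-expDensity x) x := by
  have h1 : 1 - Real.exp (-x) ≠ 0 := by
    have : Real.exp (-x) < 1 := Real.exp_lt_one_iff.mpr (by linarith)
    linarith
  have h := ((((hasDerivAt_id x).neg.exp).const_sub 1).log h1).neg
  refine h.congr_deriv ?_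
  rw [expDensity]
  have h2 : Real.exp x - 1 ≠ 0 := (sub_pos.mpr (Real.one_lt_exp_iff.mpr hx)).ne'
  have := Real.exp_pos x
  simp only [id, Pi.neg_apply] at *
  rw [Real.exp_neg] at *
  field_simp

lemma tailMass_nonneg {x : ℝ} (hx : 0 < x) : 0 ≤ tailMass x := by
  have : Real.exp (-x) < 1 := Real.exp_lt_one_iff.mpr (by linarith)
  exact neg_nonneg.mpr (Real.log_nonpos (by linarith) (by linarith [Real.exp_pos (-x)]))

lemma tailMass_le {x y : ℝ} (hx : 0 < x) (hxy : x ≤ y) : tailMass y ≤ tailMass x := by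
  have h1 : Real.exp (-x) < 1 := Real.exp_lt_one_iff.mpr (by linarith)
  have h2 : Real.exp (-y) ≤ Real.exp (-x) := Real.exp_le_exp.mpr (by linarith)
  exact neg_le_neg (Real.log_le_log (by linarith) (by linarith))

lemma tendsto_tailMass_atTop : Tendsto tailMass atTop (𝓝 0) := by
  have h : Tendsto (fun x : ℝ => 1 - Real.exp (-x)) atTop (𝓝 1) := by
    simpa using Real.tendsto_exp_neg_atTop_nhds_zero.const_sub 1
  simpa [tailMass] using! (h.log one_ne_zero).neg

lemma lintegral_Ioo_expDensity {u v : ℝ} (hu : 0 < u) (huv : u < v) (p : ℕ) :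
    ∫⁻ x in Ioo u v, ENNReal.ofReal (expDensity x) * dividedPow p (tailMass x - tailMass v) =
      dividedPow (p + 1) (tailMass u - tailMass v) := by
  have hderiv : ∀ x ∈ uIcc u v, HasDerivAt
      (fun x => -((tailMass x - tailMass v) ^ (p + 1) / (p + 1).factorial))
      (expDensity x * ((tailMass x - tailMass v) ^ p / p.factorial)) x := by
    intro x hx
    rw [uIcc_of_le huv.le] at hx
    have h := ((((hasDerivAt_tailMass (hu.trans_le hx.1)).sub_const (tailMass v)).pow
      (p + 1)).div_const ((p + 1).factorial : ℝ)).neg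
    refine h.congr_deriv ?_
    rw [Nat.factorial_succ]
    push_cast
    field_simp
  have hcont : ContinuousOn
      (fun x => expDensity x * ((tailMass x - tailMass v) ^ p / p.factorial)) (uIcc u v) := by
    rw [uIcc_of_le huv.le]
    have h1 : ContinuousOn tailMass (Icc u v) := fun x hx =>
      (hasDerivAt_tailMass (hu.trans_le hx.1)).continuousAt.continuousWithinAt
    have h2 : ContinuousOn expDensity (Icc u v) :=
      (Real.continuous_exp.continuousOn.sub continuousOn_const).inv₀ fun x hx =>
        (sub_pos.mpr (Real.one_lt_exp_iff.mpr (hu.trans_le hx.1))).ne'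
    exact h2.mul (((h1.sub continuousOn_const).pow p).div_const _)
  have hint := intervalIntegral.integral_eq_sub_of_hasDerivAt hderiv hcont.intervalIntegrable
  rw [intervalIntegral.integral_of_le huv.le, ← integral_Ioc_eq_integral_Ioo.symm] at hint
  have hnn : ∀ x ∈ Ioo u v, 0 ≤ (tailMass x - tailMass v) ^ p / p.factorial := fun x hx => by
    have := tailMass_le (hu.trans hx.1) hx.2.le
    have : 0 ≤ tailMass x - tailMass v := by linarith
    positivity
  have h3 := ofReal_integral_eq_lintegral_ofReal
    (μ := volume.restrict (Ioo u v))
    ((uIcc_of_le huv.le ▸ hcont).integrableOn_Icc.mono_set Ioo_subset_Icc_self)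
    ((ae_restrict_mem measurableSet_Ioo).mono fun x hx =>
      mul_nonneg (expDensity_pos (hu.trans hx.1)).le (hnn x hx))
  rw [hint] at h3
  rw [dividedPow]
  refine Eq.trans ?_ (h3.symm.trans ?_)
  · refine setLIntegral_congr_fun measurableSet_Ioo fun x hx => ?_
    exact (ENNReal.ofReal_mul (expDensity_pos (hu.trans hx.1)).le).symm
  · simp

lemma lintegral_Ioi_expDensity {u : ℝ} (hu : 0 < u) (p : ℕ) :
    ∫⁻ x in Ioi u, ENNReal.ofReal (expDensity x) * dividedPow p (tailMass x) =
      dividedPow (p + 1) (tailMass u) := by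
  have hderiv : ∀ x ∈ Ici u, HasDerivAt
      (fun x => -(tailMass x ^ (p + 1) / (p + 1).factorial))
      (expDensity x * (tailMass x ^ p / p.factorial)) x := by
    intro x hx
    have h := (((hasDerivAt_tailMass (hu.trans_le hx)).pow
      (p + 1)).div_const ((p + 1).factorial : ℝ)).neg
    refine h.congr_deriv ?_
    rw [Nat.factorial_succ]
    push_cast
    field_simp
  have hnn : ∀ x ∈ Ioi u, 0 ≤ expDensity x * (tailMass x ^ p / p.factorial) := fun x hx => by
    have h1 := tailMass_nonneg (hu.trans hx)
    have h2 := expDensity_pos (hu.trans hx)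
    positivity
  have hlim : Tendsto (fun x => -(tailMass x ^ (p + 1) / (p + 1).factorial)) atTop (𝓝 0) := by
    simpa using ((tendsto_tailMass_atTop.pow (p + 1)).div_const ((p + 1).factorial : ℝ)).neg
  have h3 := ofReal_integral_eq_lintegral_ofReal
    (integrableOn_Ioi_deriv_of_nonneg' hderiv hnn hlim)
    ((ae_restrict_mem measurableSet_Ioi).mono hnn)
  rw [integral_Ioi_of_hasDerivAt_of_nonneg' hderiv hnn hlim] at h3
  rw [dividedPow]
  refine Eq.trans ?_ (h3.symm.trans ?_)
  · refine setLIntegral_congr_fun measurableSet_Ioi fun x hx => ?_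
    exact (ENNReal.ofReal_mul (expDensity_pos (hu.trans hx)).le).symm
  · simp

/-- The generating function `∑ weightSum p c M * e ^ (-(M + 1) u)`. -/
noncomputable def weightSeries (p c : ℕ) (u : ℝ) : ℝ≥0∞ :=
  ∑' M : ℕ, ENNReal.ofReal (Real.exp (-((M + 1) * u))) * weightSum p c M

@[fun_prop]
lemma measurable_weightSeries (p c : ℕ) : Measurable (weightSeries p c) := by
  unfold weightSeries
  exact Measurable.tsum fun M => by fun_prop

lemma weightSeries_zero (c : ℕ) {u : ℝ} (hu : 0 < u) :
    weightSeries 0 c u = if c = 0 then ENNReal.ofReal (expDensity u) else 0 := by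
  split_ifs with h <;> simp [weightSeries, weightSum, h, ofReal_expDensity hu]

lemma lintegral_dividedPow_mul_weightSeries (p b c : ℕ) (u : ℝ) :
    ∫⁻ x in Ioi u, dividedPow b (x - u) * weightSeries p c x =
      ∑' m : ℕ, ENNReal.ofReal (Real.exp (-((m + 1) * u))) *
        ((((m : ℝ≥0∞) + 1) ^ (b + 1))⁻¹ * weightSum p c m) := by
  simp only [weightSeries, ← ENNReal.tsum_mul_left]
  rw [lintegral_tsum fun m => by fun_prop]
  refine tsum_congr fun m => ?_
  rw [← mul_assoc, ← lintegral_Ioi_dividedPow_mul_exp, ← lintegral_mul_const _ (by fun_prop)]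
  simp only [mul_assoc]

lemma weightSeries_succ (p c : ℕ) {u : ℝ} (hu : 0 < u) :
    weightSeries (p + 1) c u = ENNReal.ofReal (expDensity u) *
      ∫⁻ x in Ioi u, ∑ b ∈ Finset.HasAntidiagonal.antidiagonal c,
        dividedPow b.1 (x - u) * weightSeries p b.2 x := by
  rw [lintegral_finsetSum _ fun b _ => by fun_prop]
  simp only [lintegral_dividedPow_mul_weightSeries]
  rw [← Summable.tsum_finsetSum fun _ _ => ENNReal.summable]
  simp only [← Finset.mul_sum]
  rw [ofReal_expDensity hu, tsum_exp_mul_tsum]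
  rfl

lemma TENN_eq_lintegral (k a r : ℕ) :
    TENN k a r = ∫⁻ u in Ioi (0 : ℝ), dividedPow r u *
      ∑ b ∈ Finset.HasAntidiagonal.antidiagonal a, dividedPow b.1 u * weightSeries k b.2 u := by
  have h : ∀ u ∈ Ioi (0 : ℝ), dividedPow r u *
      ∑ b ∈ Finset.HasAntidiagonal.antidiagonal a, dividedPow b.1 u * weightSeries k b.2 u =
      ∑ b ∈ Finset.HasAntidiagonal.antidiagonal a, ((b.1 + r).choose r : ℝ≥0∞) *
        (dividedPow (b.1 + r) (u - 0) * weightSeries k b.2 u) := by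
    intro u hu
    rw [Finset.mul_sum]
    refine Finset.sum_congr rfl fun b _ => ?_
    rw [← mul_assoc, dividedPow_mul _ _ (le_of_lt hu), mul_assoc, sub_zero]
  rw [setLIntegral_congr_fun measurableSet_Ioi h, lintegral_finsetSum _ fun b _ => by fun_prop,
    TENN]
  refine Finset.sum_congr rfl fun b _ => ?_
  rw [lintegral_const_mul _ (by fun_prop), lintegral_dividedPow_mul_weightSeries]
  simp

lemma lintegral_Ioi_Ioi_swap (u : ℝ) {f : ℝ → ℝ → ℝ≥0∞} (hf : Measurable (Function.uncurry f)) :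
    ∫⁻ x in Ioi u, ∫⁻ v in Ioi x, f x v = ∫⁻ v in Ioi u, ∫⁻ x in Ioo u v, f x v := by
  have hm : Measurable (Function.uncurry fun x v : ℝ =>
      (Ioi u).indicator (fun x => (Ioi x).indicator (f x) v) x) := by
    have : (Function.uncurry fun x v : ℝ =>
        (Ioi u).indicator (fun x => (Ioi x).indicator (f x) v) x) =
        ({z : ℝ × ℝ | u < z.1} ∩ {z | z.1 < z.2}).indicator (Function.uncurry f) := by
      funext ⟨x, v⟩
      by_cases h1 : u < x <;> by_cases h2 : x < v <;> simp [h1, h2]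
    rw [this]
    exact hf.indicator ((measurableSet_lt measurable_const measurable_fst).inter
      (measurableSet_lt measurable_fst measurable_snd))
  have h1 : ∀ x, (Ioi u).indicator (fun x => ∫⁻ v in Ioi x, f x v) x =
      ∫⁻ v, (Ioi u).indicator (fun x => (Ioi x).indicator (f x) v) x := by
    intro x
    by_cases hx : x ∈ Ioi u
    · simp only [indicator_of_mem hx]
      exact (lintegral_indicator measurableSet_Ioi _).symm
    · simp [indicator_of_notMem hx]
  have h2 : ∀ v, (Ioi u).indicator (fun v => ∫⁻ x in Ioo u v, f x v) v =
      ∫⁻ x, (Ioi u).indicator (fun x => (Ioi x).indicator (f x) v) x := by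
    intro v
    have h3 : ∀ x, (Ioi u).indicator (fun x => (Ioi x).indicator (f x) v) x =
        (Ioo u v).indicator (fun x => f x v) x := by
      intro x
      by_cases h1 : u < x <;> by_cases h2 : x < v <;> simp [h1, h2]
    rw [lintegral_congr h3, lintegral_indicator measurableSet_Ioo]
    by_cases hv : v ∈ Ioi u
    · rw [indicator_of_mem hv]
    · rw [indicator_of_notMem hv, Ioo_eq_empty hv]
      simp
  rw [← lintegral_indicator measurableSet_Ioi, ← lintegral_indicator measurableSet_Ioi,
    lintegral_congr h1, lintegral_congr h2]
  exact lintegral_lintegral_swap hm.aemeasurable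

lemma weightSeries_eq_lintegral (p c : ℕ) {u : ℝ} (hu : 0 < u) :
    weightSeries (p + 1) c u = ENNReal.ofReal (expDensity u) *
      ∫⁻ v in Ioi u, dividedPow c (v - u) * dividedPow p (tailMass u - tailMass v) *
        ENNReal.ofReal (expDensity v) := by
  induction p generalizing c u with
  | zero =>
    rw [weightSeries_succ 0 c hu]
    congr 1
    refine setLIntegral_congr_fun measurableSet_Ioi fun x hx => ?_
    rw [Finset.sum_eq_single (c, 0)]
    · simp [weightSeries_zero _ (hu.trans hx)]
    · rintro ⟨b, c'⟩ hb hne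
      rw [Finset.HasAntidiagonal.mem_antidiagonal] at hb
      have hc' : c' ≠ 0 := by
        rintro rfl
        exact hne (by simpa using hb)
      simp [weightSeries_zero _ (hu.trans hx), hc']
    · simp
  | succ p ih =>
    rw [weightSeries_succ (p + 1) c hu]
    congr 1
    have h : ∀ x ∈ Ioi u, ∑ b ∈ Finset.HasAntidiagonal.antidiagonal c,
        dividedPow b.1 (x - u) * weightSeries (p + 1) b.2 x =
        ∫⁻ v in Ioi x, dividedPow c (v - u) * ENNReal.ofReal (expDensity v) *
          (ENNReal.ofReal (expDensity x) * dividedPow p (tailMass x - tailMass v)) := by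
      intro x hx
      have h1 : ∀ v ∈ Ioi x, dividedPow c (v - u) * ENNReal.ofReal (expDensity v) *
          (ENNReal.ofReal (expDensity x) * dividedPow p (tailMass x - tailMass v)) =
          ∑ b ∈ Finset.HasAntidiagonal.antidiagonal c,
            dividedPow b.1 (x - u) * ENNReal.ofReal (expDensity x) *
              (dividedPow b.2 (v - x) * dividedPow p (tailMass x - tailMass v) *
                ENNReal.ofReal (expDensity v)) := by
        intro v hv
        have hv' : v - u = (x - u) + (v - x) := by ring
        rw [hv', dividedPow_add c (sub_nonneg.mpr (le_of_lt hx)) (sub_nonneg.mpr (le_of_lt hv)),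
          Finset.sum_mul, Finset.sum_mul]
        exact Finset.sum_congr rfl fun b _ => by ring
      rw [setLIntegral_congr_fun measurableSet_Ioi h1,
        lintegral_finsetSum _ fun b _ => by fun_prop]
      refine Finset.sum_congr rfl fun b _ => ?_
      rw [lintegral_const_mul _ (by fun_prop), ih _ (hu.trans hx), mul_assoc]
    rw [setLIntegral_congr_fun measurableSet_Ioi h, lintegral_Ioi_Ioi_swap u (by fun_prop)]
    refine setLIntegral_congr_fun measurableSet_Ioi fun v hv => ?_
    rw [lintegral_const_mul _ (by fun_prop), lintegral_Ioo_expDensity hu hv]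
    ring

lemma weightSeries_zero_right (k : ℕ) {u : ℝ} (hu : 0 < u) :
    weightSeries k 0 u = ENNReal.ofReal (expDensity u) * dividedPow k (tailMass u) := by
  induction k generalizing u with
  | zero => simp [weightSeries_zero 0 hu]
  | succ k ih =>
    rw [weightSeries_succ k 0 hu, ← lintegral_Ioi_expDensity hu]
    congr 1
    refine setLIntegral_congr_fun measurableSet_Ioi fun x hx => ?_
    simp [ih (hu.trans hx)]

lemma TENN_depth_eq_lintegral (k r : ℕ) :
    TENN k 0 r = ∫⁻ u in Ioi (0 : ℝ), dividedPow r u *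
      (ENNReal.ofReal (expDensity u) * dividedPow k (tailMass u)) := by
  rw [TENN_eq_lintegral]
  refine setLIntegral_congr_fun measurableSet_Ioi fun u hu => ?_
  simp [weightSeries_zero_right k hu]

lemma TENN_succ_eq_lintegral (k a r : ℕ) :
    TENN (k + 1) a r = ∫⁻ u in Ioi (0 : ℝ), ∫⁻ v in Ioi u,
      dividedPow r u * dividedPow a v * dividedPow k (tailMass u - tailMass v) *
        ENNReal.ofReal (expDensity u) * ENNReal.ofReal (expDensity v) := by
  rw [TENN_eq_lintegral]
  refine setLIntegral_congr_fun measurableSet_Ioi fun u hu => ?_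
  have hu0 : 0 ≤ u := le_of_lt hu
  have h1 : ∀ v ∈ Ioi u, dividedPow r u * dividedPow a v *
      dividedPow k (tailMass u - tailMass v) * ENNReal.ofReal (expDensity u) *
        ENNReal.ofReal (expDensity v) =
      ∑ b ∈ Finset.HasAntidiagonal.antidiagonal a, dividedPow r u *
        (dividedPow b.1 u * ENNReal.ofReal (expDensity u)) *
          (dividedPow b.2 (v - u) * dividedPow k (tailMass u - tailMass v) *
            ENNReal.ofReal (expDensity v)) := by
    intro v hv
    have hv' : dividedPow a v = dividedPow a (u + (v - u)) := by rw [add_sub_cancel]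
    rw [hv', dividedPow_add a hu0 (sub_nonneg.mpr (le_of_lt hv)), Finset.mul_sum,
      Finset.sum_mul, Finset.sum_mul, Finset.sum_mul]
    exact Finset.sum_congr rfl fun b _ => by ring
  rw [setLIntegral_congr_fun measurableSet_Ioi h1, lintegral_finsetSum _ fun b _ => by fun_prop,
    Finset.mul_sum]
  refine Finset.sum_congr rfl fun b _ => ?_
  rw [lintegral_const_mul _ (by fun_prop), weightSeries_eq_lintegral _ _ hu]
  ring

/-- The integrand whose integral over the positive half-line is `ζ(r + 1, {1}^i)`. -/
noncomputable def depthIntegrand (r i : ℕ) (u : ℝ) : ℝ :=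
  u ^ r / r.factorial * (expDensity u * (tailMass u ^ i / i.factorial))

@[fun_prop]
lemma measurable_depthIntegrand (r i : ℕ) : Measurable (depthIntegrand r i) := by
  unfold depthIntegrand
  fun_prop

lemma depthIntegrand_nonneg (r i : ℕ) {u : ℝ} (hu : 0 < u) : 0 ≤ depthIntegrand r i u := by
  have h1 := tailMass_nonneg hu
  have h2 := expDensity_pos hu
  unfold depthIntegrand
  positivity

lemma lintegral_depthIntegrand (r i : ℕ) :
    ∫⁻ u in Ioi (0 : ℝ), ENNReal.ofReal (depthIntegrand r i u) = TENN i 0 r := by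
  rw [TENN_depth_eq_lintegral]
  refine setLIntegral_congr_fun measurableSet_Ioi fun u hu => ?_
  have hu0 : (0 : ℝ) < u := hu
  simp only [depthIntegrand, dividedPow]
  rw [ENNReal.ofReal_mul (by positivity), ENNReal.ofReal_mul (expDensity_pos hu0).le]

lemma integrable_depthIntegrand {r : ℕ} (hr : 1 ≤ r) (i : ℕ) :
    Integrable (depthIntegrand r i) (volume.restrict (Ioi 0)) := by
  refine ⟨by fun_prop, ?_⟩
  rw [hasFiniteIntegral_iff_ofReal
    ((ae_restrict_mem measurableSet_Ioi).mono fun u hu => depthIntegrand_nonneg r i hu),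
    lintegral_depthIntegrand]
  exact (TENN_depth_ne_top i hr).lt_top

lemma integral_depthIntegrand (r i : ℕ) :
    ∫ u in Ioi (0 : ℝ), depthIntegrand r i u = (TENN i 0 r).toReal := by
  rw [integral_eq_lintegral_of_nonneg_ae
    ((ae_restrict_mem measurableSet_Ioi).mono fun u hu => depthIntegrand_nonneg r i hu)
    (by fun_prop), lintegral_depthIntegrand]

/-- The integrand whose integral over `0 < u < v` is `T` in depth `j + 2`. -/
noncomputable def pairIntegrand (r a j : ℕ) (z : ℝ × ℝ) : ℝ :=
  z.1 ^ r / r.factorial * (z.2 ^ a / a.factorial) *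
    ((tailMass z.1 - tailMass z.2) ^ j / j.factorial) * expDensity z.1 * expDensity z.2

@[fun_prop]
lemma measurable_pairIntegrand (r a j : ℕ) : Measurable (pairIntegrand r a j) := by
  unfold pairIntegrand
  fun_prop

lemma pairIntegrand_nonneg (r a j : ℕ) {u v : ℝ} (hu : 0 < u) (huv : u ≤ v) :
    0 ≤ pairIntegrand r a j (u, v) := by
  have hv := hu.trans_le huv
  have h1 := expDensity_pos hu
  have h2 := expDensity_pos hv
  have h3 : 0 ≤ tailMass u - tailMass v := sub_nonneg.mpr (tailMass_le hu huv)
  simp only [pairIntegrand]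
  positivity

lemma ofReal_pairIntegrand (r a j : ℕ) {u v : ℝ} (hu : 0 < u) (huv : u ≤ v) :
    ENNReal.ofReal (pairIntegrand r a j (u, v)) =
      dividedPow r u * dividedPow a v * dividedPow j (tailMass u - tailMass v) *
        ENNReal.ofReal (expDensity u) * ENNReal.ofReal (expDensity v) := by
  have hv := hu.trans_le huv
  have h1 := expDensity_pos hu
  have h2 := expDensity_pos hv
  have h3 : 0 ≤ tailMass u - tailMass v := sub_nonneg.mpr (tailMass_le hu huv)
  simp only [pairIntegrand, dividedPow]
  rw [ENNReal.ofReal_mul (by positivity), ENNReal.ofReal_mul (by positivity),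
    ENNReal.ofReal_mul (by positivity), ENNReal.ofReal_mul (by positivity)]

lemma neg_one_pow_mul_pairIntegrand (r a j : ℕ) (u v : ℝ) :
    (-1) ^ j * pairIntegrand r a j (u, v) = pairIntegrand a r j (v, u) := by
  have h : (tailMass v - tailMass u) ^ j = (-1) ^ j * (tailMass u - tailMass v) ^ j := by
    rw [← mul_pow]
    ring
  simp only [pairIntegrand, h]
  ring

lemma pairIntegrand_eq_sum (r a j : ℕ) (z : ℝ × ℝ) :
    pairIntegrand r a j z = ∑ b ∈ Finset.HasAntidiagonal.antidiagonal j,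
      (-1) ^ b.2 * (depthIntegrand r b.1 z.1 * depthIntegrand a b.2 z.2) := by
  simp only [pairIntegrand, depthIntegrand]
  rw [sub_eq_add_neg, add_pow_div_factorial, Finset.mul_sum, Finset.sum_mul, Finset.sum_mul]
  refine Finset.sum_congr rfl fun b _ => ?_
  rw [neg_pow (tailMass z.2)]
  ring

lemma integrable_pairIntegrand {r a : ℕ} (hr : 1 ≤ r) (ha : 1 ≤ a) (j : ℕ) :
    Integrable (pairIntegrand r a j)
      ((volume.restrict (Ioi 0)).prod (volume.restrict (Ioi 0))) := by
  rw [funext (pairIntegrand_eq_sum r a j)]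
  exact integrable_finsetSum _ fun b _ =>
    ((integrable_depthIntegrand hr b.1).mul_prod (integrable_depthIntegrand ha b.2)).const_mul _

lemma integral_pairIntegrand {r a : ℕ} (hr : 1 ≤ r) (ha : 1 ≤ a) (j : ℕ) :
    ∫ z, pairIntegrand r a j z ∂((volume.restrict (Ioi 0)).prod (volume.restrict (Ioi 0))) =
      ∑ b ∈ Finset.HasAntidiagonal.antidiagonal j,
        (-1) ^ b.2 * ((TENN b.1 0 r).toReal * (TENN b.2 0 a).toReal) := by
  rw [funext (pairIntegrand_eq_sum r a j), integral_finsetSum _ fun b _ =>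
    ((integrable_depthIntegrand hr b.1).mul_prod (integrable_depthIntegrand ha b.2)).const_mul _]
  refine Finset.sum_congr rfl fun b _ => ?_
  rw [integral_const_mul, integral_prod_mul (depthIntegrand r b.1) (depthIntegrand a b.2),
    integral_depthIntegrand, integral_depthIntegrand]

lemma measurableSet_fst_lt_snd : MeasurableSet {z : ℝ × ℝ | z.1 < z.2} :=
  measurableSet_lt measurable_fst measurable_snd

lemma ae_prod_restrict_Ioi_pos :
    ∀ᵐ z : ℝ × ℝ ∂((volume.restrict (Ioi 0)).prod (volume.restrict (Ioi 0))),
      0 < z.1 ∧ 0 < z.2 := by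
  rw [Measure.prod_restrict]
  exact ae_restrict_mem (measurableSet_Ioi.prod measurableSet_Ioi)

lemma lintegral_pairIntegrand_lt (r a j : ℕ) :
    ∫⁻ z in {z : ℝ × ℝ | z.1 < z.2}, ENNReal.ofReal (pairIntegrand r a j z)
      ∂((volume.restrict (Ioi 0)).prod (volume.restrict (Ioi 0))) = TENN (j + 1) a r := by
  rw [← lintegral_indicator measurableSet_fst_lt_snd, lintegral_prod _
    ((Measurable.ennreal_ofReal (by fun_prop)).indicator measurableSet_fst_lt_snd).aemeasurable,
    TENN_succ_eq_lintegral]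
  refine setLIntegral_congr_fun measurableSet_Ioi fun u hu => ?_
  have hind : ∀ v : ℝ, {z : ℝ × ℝ | z.1 < z.2}.indicator
      (fun z => ENNReal.ofReal (pairIntegrand r a j z)) (u, v) =
      (Ioi u).indicator (fun v => ENNReal.ofReal (pairIntegrand r a j (u, v))) v := by
    intro v
    by_cases h : u < v <;> simp [h]
  simp only [hind]
  rw [lintegral_indicator measurableSet_Ioi, Measure.restrict_restrict measurableSet_Ioi,
    Ioi_inter_Ioi, sup_of_le_left (le_of_lt hu)]
  exact setLIntegral_congr_fun measurableSet_Ioi fun v hv =>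
    ofReal_pairIntegrand r a j hu (le_of_lt hv)

lemma lintegral_pairIntegrand_ge (r a j : ℕ) :
    ∫⁻ z in {z : ℝ × ℝ | z.1 < z.2}ᶜ, ENNReal.ofReal ((-1) ^ j * pairIntegrand r a j z)
      ∂((volume.restrict (Ioi 0)).prod (volume.restrict (Ioi 0))) = TENN (j + 1) r a := by
  rw [← lintegral_indicator measurableSet_fst_lt_snd.compl, lintegral_prod_symm _
    ((Measurable.ennreal_ofReal (by fun_prop)).indicator
      measurableSet_fst_lt_snd.compl).aemeasurable, TENN_succ_eq_lintegral]
  refine setLIntegral_congr_fun measurableSet_Ioi fun u hu => ?_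
  have hind : ∀ v : ℝ, {z : ℝ × ℝ | z.1 < z.2}ᶜ.indicator
      (fun z => ENNReal.ofReal ((-1) ^ j * pairIntegrand r a j z)) (v, u) =
      (Ici u).indicator (fun v => ENNReal.ofReal (pairIntegrand a r j (u, v))) v := by
    intro v
    have hsymm := neg_one_pow_mul_pairIntegrand r a j v u
    by_cases h : u ≤ v <;> simp [h, hsymm]
  simp only [hind]
  have hsub : Ici u ∩ Ioi 0 = Ici u := inter_eq_left.mpr fun v hv =>
    mem_Ioi.mpr (lt_of_lt_of_le (mem_Ioi.mp hu) (mem_Ici.mp hv))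
  rw [lintegral_indicator measurableSet_Ici, Measure.restrict_restrict measurableSet_Ici, hsub,
    setLIntegral_congr Ioi_ae_eq_Ici.symm]
  exact setLIntegral_congr_fun measurableSet_Ioi fun v hv =>
    ofReal_pairIntegrand a r j hu (le_of_lt hv)

lemma TENN_succ_ne_top {r a : ℕ} (hr : 1 ≤ r) (ha : 1 ≤ a) (j : ℕ) : TENN (j + 1) a r ≠ ∞ := by
  rw [← lintegral_pairIntegrand_lt]
  exact (integrable_pairIntegrand hr ha j).integrableOn.lintegral_lt_top.ne

lemma TENN_succ_sum_identity {r a : ℕ} (hr : 1 ≤ r) (ha : 1 ≤ a) (j : ℕ) :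
    (TENN (j + 1) a r).toReal + (-1) ^ j * (TENN (j + 1) r a).toReal =
      ∑ b ∈ Finset.HasAntidiagonal.antidiagonal j,
        (-1) ^ b.2 * ((TENN b.1 0 r).toReal * (TENN b.2 0 a).toReal) := by
  rw [← integral_pairIntegrand hr ha,
    ← integral_add_compl measurableSet_fst_lt_snd (integrable_pairIntegrand hr ha j)]
  congr 1
  · rw [integral_eq_lintegral_of_nonneg_ae _ (by fun_prop), lintegral_pairIntegrand_lt]
    filter_upwards [ae_restrict_mem measurableSet_fst_lt_snd,
      ae_restrict_of_ae ae_prod_restrict_Ioi_pos] with z hz hpos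
    exact pairIntegrand_nonneg r a j hpos.1 (le_of_lt hz)
  · have h : ∀ z, pairIntegrand r a j z = (-1) ^ j * ((-1) ^ j * pairIntegrand r a j z) := by
      intro z
      rw [← mul_assoc, ← mul_pow]
      simp
    rw [integral_congr_ae (ae_of_all _ h), integral_const_mul,
      integral_eq_lintegral_of_nonneg_ae _ (by fun_prop), lintegral_pairIntegrand_ge]
    filter_upwards [ae_restrict_mem measurableSet_fst_lt_snd.compl,
      ae_restrict_of_ae ae_prod_restrict_Ioi_pos] with z hz hpos
    have := pairIntegrand_nonneg a r j hpos.2 (not_lt.mp hz)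
    rwa [← neg_one_pow_mul_pairIntegrand] at this

lemma TENN_zero_ne_top {a r : ℕ} (hr : 1 ≤ r) : TENN 0 a r ≠ ∞ := by
  have h := TENN_depth_ne_top 0 (r := a + r) (by omega)
  rw [TENN_zero] at h ⊢
  refine ENNReal.mul_ne_top (ENNReal.natCast_ne_top _) ?_
  simpa using h

lemma TENN_zero_comm (a r : ℕ) : TENN 0 a r = TENN 0 r a := by
  rw [TENN_zero, TENN_zero, add_comm a r, Nat.choose_symm_add]

/-- Remark 2.1 of Machide (equivalent to Arakawa–Kaneko): for `l > n ≥ 1` and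
`1 ≤ r ≤ l - n - 1`,
`T(l,n;r) + (-1)^n T(l,n;l-n-r)
  = Σ_{j₁,j₂≥1, j₁+j₂=n} (-1)^(j₂-1) ζ(r+1,{1}^(j₁-1)) ζ(l-n-r+1,{1}^(j₂-1))`. -/
theorem T_sum_identity (l n r : ℕ) (hn : 1 ≤ n) (hln : n < l)
    (hr : 1 ≤ r) (hr' : r ≤ l - n - 1) :
    T l n r + (-1 : ℝ) ^ n * T l n (l - n - r)
      = ∑ j₁ ∈ Finset.Icc 1 (n - 1), (-1 : ℝ) ^ (n - j₁ - 1)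
          * mzv (Fin.cons (r + 1) (fun _ : Fin (j₁ - 1) => 1))
          * mzv (Fin.cons (l - n - r + 1) (fun _ : Fin (n - j₁ - 1) => 1)) := by
  obtain ⟨k, rfl⟩ : ∃ k, n = k + 1 := ⟨n - 1, by omega⟩
  obtain ⟨a, ha⟩ : ∃ a, a = l - (k + 1) - r := ⟨_, rfl⟩
  have ha1 : 1 ≤ a := by omega
  have hl : l = a + r + (k + 1) := by omega
  have hl' : l = r + a + (k + 1) := by omega
  simp only [mzv_cons_one_eq_toReal, ← ha]
  have hne : ∀ {b s : ℕ}, 1 ≤ b → 1 ≤ s → TENN k b s ≠ ∞ := by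
    intro b s hb hs
    cases k with
    | zero => exact TENN_zero_ne_top hs
    | succ j => exact TENN_succ_ne_top hs hb j
  have hT1 : T l (k + 1) r = (TENN k a r).toReal := by
    rw [hl, T_eq_toReal (hne ha1 hr)]
  have hT2 : T l (k + 1) a = (TENN k r a).toReal := by
    rw [hl', T_eq_toReal (hne hr ha1)]
  rw [hT1, hT2]
  cases k with
  | zero => simp [TENN_zero_comm a r]
  | succ j =>
    have hsign : (-1 : ℝ) ^ (j + 1 + 1) = (-1) ^ j := by ring
    rw [hsign, TENN_succ_sum_identity hr ha1]
    refine Finset.sum_nbij' (fun b => b.1 + 1) (fun i => (i - 1, j + 1 - i)) ?_ ?_ ?_ ?_ ?_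
    · intro b hb
      rw [Finset.HasAntidiagonal.mem_antidiagonal] at hb
      rw [Finset.mem_Icc]
      omega
    · intro i hi
      rw [Finset.mem_Icc] at hi
      rw [Finset.HasAntidiagonal.mem_antidiagonal]
      omega
    · rintro ⟨b, c⟩ hb
      rw [Finset.HasAntidiagonal.mem_antidiagonal] at hb
      simp only [Prod.mk.injEq]
      omega
    · intro i hi
      rw [Finset.mem_Icc] at hi
      omega
    · rintro ⟨b, c⟩ hb
      rw [Finset.HasAntidiagonal.mem_antidiagonal] at hb
      have h1 : j + 1 + 1 - (b + 1) - 1 = c := by omega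
      simp only [h1, Nat.add_sub_cancel, mul_assoc]
end

section
/- For any integer l ≥ 3 and complex numbers x, y, one has G_l^2(x+y, y) + G_l^2(y+x, x) = ((l+1)/2)(x^{l−2} + y^{l−2}) ζ(l) − (1/2) Σ_{j₁,j₂≥2, j₁+j₂=l} (x^{j₁−1} − y^{j₁−1})(x^{j₂−1} − y^{j₂−1}) ζ(j₁) ζ(j₂). -/
open scoped BigOperators

/-- The weighted sum with two parameters
`G_l^n(x,y) = Σ_{l₁≥2, l₂,…,lₙ≥1, l₁+⋯+lₙ=l} x^(l₁-1) y^(l-l₁-(n-1)) ζ(l₁,…,lₙ)`. -/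
noncomputable def G (l n : ℕ) (x y : ℂ) : ℂ :=
  match n with
  | 0 => 0
  | k + 1 =>
    ∑ c ∈ (Finset.Nat.antidiagonalTuple (k + 1) l).filter
        (fun c => 2 ≤ c 0 ∧ ∀ i, 1 ≤ c i),
      x ^ (c 0 - 1) * y ^ (l - c 0 - k) * (mzv c : ℂ)

/-- The complete homogeneous symmetric polynomial of degree `n` in two variables. -/
noncomputable def homog (n : ℕ) (a b : ℂ) : ℂ := ∑ i ∈ Finset.range (n + 1), a ^ i * b ^ (n - i)

lemma homog_succ_left (n : ℕ) (a b : ℂ) : homog (n + 1) a b = a * homog n a b + b ^ (n + 1) := by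
  unfold homog
  rw [Finset.sum_range_succ', Finset.mul_sum]
  congr 1
  · refine Finset.sum_congr rfl fun i _ => ?_
    rw [Nat.add_sub_add_right]
    ring
  · simp

lemma homog_comm (n : ℕ) (a b : ℂ) : homog n a b = homog n b a := by
  unfold homog
  rw [← Finset.sum_range_reflect]
  refine Finset.sum_congr rfl fun i hi => ?_
  have hi' : i ≤ n := by simpa [Nat.lt_succ_iff] using hi
  have h1 : n + 1 - 1 - i = n - i := by omega
  rw [h1, Nat.sub_sub_self hi', mul_comm]

lemma homog_succ_right (n : ℕ) (a b : ℂ) :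
    homog (n + 1) a b = b * homog n a b + a ^ (n + 1) := by
  rw [homog_comm, homog_succ_left, homog_comm]

lemma exists_homog_sub_eq (n : ℕ) (u a b : ℂ) :
    ∃ c, homog n u b - homog n a b = (u - a) * c ∧ homog n u a - homog n a b = (u - b) * c := by
  induction n with
  | zero => exact ⟨0, by simp [homog]⟩
  | succ n ih =>
    obtain ⟨c, h₁, h₂⟩ := ih
    have h₃ : (u - a) * homog n u a = u ^ (n + 1) - a ^ (n + 1) := by
      linear_combination homog_succ_right n u a - homog_succ_left n u a
    refine ⟨b * c + homog n u a, ?_, ?_⟩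
    · rw [homog_succ_right, homog_succ_right]
      linear_combination b * h₁ - h₃
    · rw [homog_succ_left, homog_succ_right n a b]
      linear_combination b * h₂

lemma homog_partial_fractions (n : ℕ) {p q x y : ℂ} (hp : p ≠ 0) (hq : q ≠ 0)
    (hpq : p + q ≠ 0) :
    (p * q)⁻¹ * homog n (x / p) (y / q)
      = ((p + q) * q)⁻¹ * homog n ((x + y) / (p + q)) (y / q)
        + ((p + q) * p)⁻¹ * homog n ((x + y) / (p + q)) (x / p) := by
  obtain ⟨c, h₁, h₂⟩ := exists_homog_sub_eq n ((x + y) / (p + q)) (x / p) (y / q)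
  rw [sub_eq_iff_eq_add.1 h₁, sub_eq_iff_eq_add.1 h₂]
  field_simp
  ring

lemma inv_mul_homog_div (k : ℕ) (p q x y : ℂ) :
    (p * q)⁻¹ * homog (k + 1) (x / p) (y / q)
      = y ^ (k + 1) * (p⁻¹ * (q ^ (k + 2))⁻¹)
        + ∑ i ∈ Finset.range (k + 1),
            x ^ (i + 1) * y ^ (k - i) * ((p ^ (i + 2))⁻¹ * (q ^ (k + 1 - i))⁻¹) := by
  unfold homog
  rw [Finset.sum_range_succ', mul_add, Finset.mul_sum, add_comm]
  congr 1
  · simp only [pow_zero, Nat.sub_zero, mul_inv, div_eq_mul_inv]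
    ring
  · refine Finset.sum_congr rfl fun i hi => ?_
    have hi' : i ≤ k := by simpa [Nat.lt_succ_iff] using hi
    rw [Nat.add_sub_add_right, Nat.sub_add_comm hi']
    simp only [mul_inv, div_eq_mul_inv, pow_succ]
    ring

/-- The partial fraction expansion behind the shuffle product, with the non-summable terms
cancelled. -/
lemma shuffle_pointwise (k : ℕ) {p q : ℂ} (x y : ℂ) (hp : p ≠ 0) (hq : q ≠ 0)
    (hpq : p + q ≠ 0) :
    (∑ i ∈ Finset.range (k + 1),
        (x + y) ^ (i + 1) * y ^ (k - i) * (((p + q) ^ (i + 2))⁻¹ * (q ^ (k + 1 - i))⁻¹))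
      + ∑ i ∈ Finset.range (k + 1),
        (x + y) ^ (i + 1) * x ^ (k - i) * (((p + q) ^ (i + 2))⁻¹ * (p ^ (k + 1 - i))⁻¹)
    = (∑ i ∈ Finset.range k,
        x ^ (i + 1) * y ^ (k - i) * ((p ^ (i + 2))⁻¹ * (q ^ (k + 1 - i))⁻¹))
      + (y ^ (k + 1) * ((q ^ (k + 2))⁻¹ * (p⁻¹ - (p + q)⁻¹))
        + x ^ (k + 1) * ((p ^ (k + 2))⁻¹ * (q⁻¹ - (p + q)⁻¹))) := by
  have h := homog_partial_fractions (k + 1) (x := x) (y := y) hp hq hpq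
  rw [inv_mul_homog_div, inv_mul_homog_div, inv_mul_homog_div, Finset.sum_range_succ] at h
  have hk : k + 1 - k = 1 := by omega
  rw [hk, Nat.sub_self] at h
  linear_combination -h

/-- The double zeta series `∑_{p,q>0} (p+q)^{-a} q^{-b}`. -/
noncomputable def dz (a b : ℕ) : ℝ :=
  ∑' z : ℕ × ℕ, (((z.1 + 1 : ℝ) + (z.2 + 1)) ^ a)⁻¹ * ((z.2 + 1 : ℝ) ^ b)⁻¹

lemma summable_of_le_three_halves {f : ℕ × ℕ → ℝ} (h₀ : ∀ z, 0 ≤ f z)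
    (h : ∀ z, f z ≤ ((z.1 + 1 : ℝ) * √(z.1 + 1))⁻¹ * ((z.2 + 1 : ℝ) * √(z.2 + 1))⁻¹) :
    Summable f := by
  have hs : Summable fun n : ℕ => ((n + 1 : ℝ) * √(n + 1))⁻¹ := by
    have := (summable_nat_add_iff 1).2 (Real.summable_nat_rpow_inv.2 (by norm_num : (1 : ℝ) < 3 / 2))
    refine this.congr fun n => ?_
    have hn : (0 : ℝ) < n + 1 := by positivity
    rw [Real.sqrt_eq_rpow]
    push_cast
    nth_rewrite 2 [← Real.rpow_one (n + 1 : ℝ)]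
    rw [← Real.rpow_add hn]
    norm_num
  exact Summable.of_nonneg_of_le h₀ h
    (hs.mul_of_nonneg hs (fun n => by positivity) (fun n => by positivity))

lemma sqrt_mul_sqrt_le_add {p q : ℝ} (hp : 0 ≤ p) (hq : 0 ≤ q) : √p * √q ≤ p + q := by
  have h₁ := Real.sq_sqrt hp
  have h₂ := Real.sq_sqrt hq
  nlinarith [sq_nonneg (√p - √q), sq_nonneg (√p + √q)]

lemma summable_dz {a b : ℕ} (ha : 2 ≤ a) (hb : 1 ≤ b) :
    Summable fun z : ℕ × ℕ => (((z.1 + 1 : ℝ) + (z.2 + 1)) ^ a)⁻¹ * ((z.2 + 1 : ℝ) ^ b)⁻¹ := by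
  refine summable_of_le_three_halves (fun z => by positivity) fun z => ?_
  have hp : (1 : ℝ) ≤ z.1 + 1 := by simp
  have hq : (1 : ℝ) ≤ z.2 + 1 := by simp
  generalize (z.1 + 1 : ℝ) = p at *
  generalize (z.2 + 1 : ℝ) = q at *
  have h₁ : (p + q) ^ 2 ≤ (p + q) ^ a := pow_le_pow_right₀ (by linarith) ha
  have h₂ : q ^ 1 ≤ q ^ b := pow_le_pow_right₀ hq hb
  have h₃ := sqrt_mul_sqrt_le_add (zero_le_one.trans hp) (zero_le_one.trans hq)
  rw [← mul_inv, ← mul_inv]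
  refine inv_anti₀ (by positivity) ?_
  calc p * √p * (q * √q) = p * (√p * √q) * q := by ring
    _ ≤ (p + q) * (p + q) * q := by gcongr; linarith
    _ = (p + q) ^ 2 * q ^ 1 := by ring
    _ ≤ _ := by gcongr

lemma hasSum_dz {a b : ℕ} (ha : 2 ≤ a) (hb : 1 ≤ b) :
    HasSum (fun z : ℕ × ℕ => (((z.1 + 1 : ℝ) + (z.2 + 1)) ^ a)⁻¹ * ((z.2 + 1 : ℝ) ^ b)⁻¹)
      (dz a b) :=
  (summable_dz ha hb).hasSum

lemma summable_inv_pow_mul_inv_pow {a b : ℕ} (ha : 2 ≤ a) (hb : 2 ≤ b) :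
    Summable fun z : ℕ × ℕ => ((z.1 + 1 : ℝ) ^ a)⁻¹ * ((z.2 + 1 : ℝ) ^ b)⁻¹ := by
  refine summable_of_le_three_halves (fun z => by positivity) fun z => ?_
  have hp : (1 : ℝ) ≤ z.1 + 1 := by simp
  have hq : (1 : ℝ) ≤ z.2 + 1 := by simp
  generalize (z.1 + 1 : ℝ) = p at *
  generalize (z.2 + 1 : ℝ) = q at *
  have key : ∀ {r : ℝ} {c : ℕ}, 1 ≤ r → 2 ≤ c → (r ^ c)⁻¹ ≤ (r * √r)⁻¹ := fun {r c} hr hc =>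
    inv_anti₀ (by positivity) <| calc
      r * √r ≤ r * r := by gcongr; exact Real.sqrt_le_self_iff.2 (Or.inr hr)
      _ = r ^ 2 := by ring
      _ ≤ r ^ c := pow_le_pow_right₀ hr hc
  exact mul_le_mul (key hp ha) (key hq hb) (by positivity) (by positivity)

lemma summable_inv_pow_mul_inv_sub_inv (k : ℕ) :
    Summable fun z : ℕ × ℕ => ((z.1 + 1 : ℝ) ^ (k + 2))⁻¹ *
      ((z.2 + 1 : ℝ)⁻¹ - ((z.1 + 1 : ℝ) + (z.2 + 1))⁻¹) := by
  have hrw : ∀ z : ℕ × ℕ, ((z.1 + 1 : ℝ) ^ (k + 2))⁻¹ *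
      ((z.2 + 1 : ℝ)⁻¹ - ((z.1 + 1 : ℝ) + (z.2 + 1))⁻¹)
      = ((z.1 + 1 : ℝ) ^ (k + 1) * (z.2 + 1) * ((z.1 + 1 : ℝ) + (z.2 + 1)))⁻¹ := by
    intro z
    field_simp
    ring
  simp only [hrw]
  refine summable_of_le_three_halves (fun z => by positivity) fun z => ?_
  have hp : (1 : ℝ) ≤ z.1 + 1 := by simp
  have hq : (1 : ℝ) ≤ z.2 + 1 := by simp
  generalize (z.1 + 1 : ℝ) = p at *
  generalize (z.2 + 1 : ℝ) = q at *
  have h₁ : p ≤ p ^ (k + 1) := le_self_pow₀ hp (by omega)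
  have h₃ := sqrt_mul_sqrt_le_add (zero_le_one.trans hp) (zero_le_one.trans hq)
  rw [← mul_inv]
  refine inv_anti₀ (by positivity) ?_
  calc p * √p * (q * √q) = p * q * (√p * √q) := by ring
    _ ≤ _ := by gcongr

lemma rz_eq_tsum_nat (a : ℕ) : rz a = ∑' n : ℕ, ((n + 1 : ℝ) ^ a)⁻¹ := by
  unfold rz
  rw [← Equiv.pnatEquivNat.symm.tsum_eq]
  simp [Equiv.pnatEquivNat]

lemma summable_inv_succ_pow {a : ℕ} (ha : 2 ≤ a) :
    Summable fun n : ℕ => ((n + 1 : ℝ) ^ a)⁻¹ := by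
  have := (summable_nat_add_iff 1).2 (Real.summable_nat_pow_inv.2 (by omega : 1 < a))
  exact_mod_cast this

lemma hasSum_inv_pow_mul_inv_pow {a b : ℕ} (ha : 2 ≤ a) (hb : 2 ≤ b) :
    HasSum (fun z : ℕ × ℕ => ((z.1 + 1 : ℝ) ^ a)⁻¹ * ((z.2 + 1 : ℝ) ^ b)⁻¹) (rz a * rz b) := by
  rw [rz_eq_tsum_nat, rz_eq_tsum_nat]
  exact (summable_inv_succ_pow ha).hasSum.mul (summable_inv_succ_pow hb).hasSum
    (summable_inv_pow_mul_inv_pow ha hb)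

/-- The partition of the quarter plane by the diagonal. -/
noncomputable def diagonalSplit : (ℕ × ℕ) ⊕ (ℕ × ℕ) ⊕ ℕ ≃ ℕ × ℕ :=
  Equiv.ofBijective
    (Sum.elim (fun z => (z.1 + z.2 + 1, z.2)) (Sum.elim (fun z => (z.2, z.1 + z.2 + 1))
      fun n => (n, n))) <| by
    constructor
    · rintro (⟨a, b⟩ | ⟨a, b⟩ | a) (⟨c, d⟩ | ⟨c, d⟩ | c) h <;> simp at h ⊢ <;> omega
    · rintro ⟨a, b⟩
      rcases lt_trichotomy a b with h | h | h
      · exact ⟨Sum.inr (Sum.inl (b - a - 1, a)), by simp; omega⟩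
      · exact ⟨Sum.inr (Sum.inr a), by simp [h]⟩
      · exact ⟨Sum.inl (a - b - 1, b), by simp; omega⟩

lemma rz_mul_rz {a b : ℕ} (ha : 2 ≤ a) (hb : 2 ≤ b) :
    rz a * rz b = dz a b + dz b a + rz (a + b) := by
  refine (hasSum_inv_pow_mul_inv_pow ha hb).unique ?_
  rw [← diagonalSplit.hasSum_iff, add_assoc]
  refine HasSum.sum ?_ (HasSum.sum ?_ ?_)
  · refine (hasSum_dz ha (by omega : 1 ≤ b)).congr_fun fun z => ?_
    change (((z.1 + z.2 + 1 : ℕ) + 1 : ℝ) ^ a)⁻¹ * ((z.2 + 1 : ℝ) ^ b)⁻¹ = _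
    push_cast
    ring
  · refine (hasSum_dz hb (by omega : 1 ≤ a)).congr_fun fun z => ?_
    change ((z.2 + 1 : ℝ) ^ a)⁻¹ * (((z.1 + z.2 + 1 : ℕ) + 1 : ℝ) ^ b)⁻¹ = _
    push_cast
    ring
  · rw [rz_eq_tsum_nat]
    refine (summable_inv_succ_pow (by omega : 2 ≤ a + b)).hasSum.congr_fun fun n => ?_
    change ((n + 1 : ℝ) ^ a)⁻¹ * ((n + 1 : ℝ) ^ b)⁻¹ = _
    rw [pow_add, mul_inv]

lemma hasSum_inv_sub_inv_add (q : ℕ) :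
    HasSum (fun p : ℕ => (p + 1 : ℝ)⁻¹ - ((q : ℝ) + (p + 1))⁻¹)
      (∑ n ∈ Finset.range q, (n + 1 : ℝ)⁻¹) := by
  induction q with
  | zero => simp
  | succ q ih =>
    have h : HasSum (fun p : ℕ => ((q : ℝ) + (p + 1))⁻¹ - ((q : ℝ) + 1 + (p + 1))⁻¹)
        (q + 1 : ℝ)⁻¹ := by
      rw [hasSum_iff_tendsto_nat_of_nonneg]
      · have hs : ∀ n : ℕ, ∑ p ∈ Finset.range n,
            (((q : ℝ) + (p + 1))⁻¹ - ((q : ℝ) + 1 + (p + 1))⁻¹)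
            = (q + 1 : ℝ)⁻¹ - ((n + (q + 1) : ℕ) : ℝ)⁻¹ := by
          intro n
          induction n with
          | zero => simp
          | succ n ihn =>
            rw [Finset.sum_range_succ, ihn]
            push_cast
            ring
        simp only [hs]
        have := (Filter.tendsto_add_atTop_iff_nat (q + 1)).2
          (tendsto_inv_atTop_nhds_zero_nat (𝕜 := ℝ))
        simpa using this.const_sub (q + 1 : ℝ)⁻¹
      · intro p
        rw [sub_nonneg]
        exact inv_anti₀ (by positivity) (by linarith)
    rw [Finset.sum_range_succ]
    convert ih.add h using 2 with p
    push_cast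
    ring

lemma hasSum_dz_one (k : ℕ) :
    HasSum (fun n : ℕ => ((n + 1 : ℝ) ^ (k + 2))⁻¹ * ∑ j ∈ Finset.range n, (j + 1 : ℝ)⁻¹)
      (dz (k + 2) 1) := by
  rw [← hasSum_nat_add_iff' 1]
  have h := hasSum_dz (by omega : 2 ≤ k + 2) le_rfl
  rw [← Finset.HasAntidiagonal.sigmaAntidiagonalEquivProd.hasSum_iff] at h
  have h' := h.sigma fun n => hasSum_fintype _
  simp only [Finset.range_one, Finset.sum_singleton, Finset.range_zero, Finset.sum_empty, mul_zero,
    sub_zero]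
  refine h'.congr_fun fun n => ?_
  rw [Finset.univ_eq_attach, Finset.mul_sum]
  simp only [Function.comp_def, Finset.HasAntidiagonal.sigmaAntidiagonalEquivProd_apply]
  rw [Finset.sum_attach (Finset.HasAntidiagonal.antidiagonal n) (fun z : ℕ × ℕ =>
      (((z.1 + 1 : ℝ) + (z.2 + 1)) ^ (k + 2))⁻¹ * ((z.2 + 1 : ℝ) ^ 1)⁻¹),
    Finset.Nat.sum_antidiagonal_eq_sum_range_succ_mk, ← Finset.sum_range_reflect]
  refine Finset.sum_congr rfl fun i hi => ?_
  have hi' : i ≤ n := by simpa [Nat.lt_succ_iff] using hi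
  have h1 : n + 1 - 1 - i = n - i := by omega
  rw [h1, Nat.cast_sub hi']
  push_cast [Nat.cast_sub hi']
  ring

lemma hasSum_inv_pow_mul_inv_sub_inv (k : ℕ) :
    HasSum (fun z : ℕ × ℕ => ((z.1 + 1 : ℝ) ^ (k + 2))⁻¹ *
      ((z.2 + 1 : ℝ)⁻¹ - ((z.1 + 1 : ℝ) + (z.2 + 1))⁻¹)) (rz (k + 3) + dz (k + 2) 1) := by
  have hs := summable_inv_pow_mul_inv_sub_inv k
  have h₁ := hs.hasSum.prod_fiberwise fun q => by
    have := (hasSum_inv_sub_inv_add (q + 1)).mul_left ((q + 1 : ℝ) ^ (k + 2))⁻¹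
    push_cast at this
    exact this
  have h₂ := (summable_inv_succ_pow (by omega : 2 ≤ k + 3)).hasSum.add (hasSum_dz_one k)
  rw [← rz_eq_tsum_nat] at h₂
  have h₃ := h₁.unique (a₂ := rz (k + 3) + dz (k + 2) 1) <| by
    convert h₂ using 2 with q
    rw [Finset.sum_range_succ]
    field_simp
    ring
  exact h₃ ▸ hs.hasSum

lemma shuffle_sum (k : ℕ) (x y : ℂ) :
    (∑ i ∈ Finset.range (k + 1), (x + y) ^ (i + 1) * y ^ (k - i) * (dz (i + 2) (k + 1 - i) : ℂ))
      + ∑ i ∈ Finset.range (k + 1), (x + y) ^ (i + 1) * x ^ (k - i) * (dz (i + 2) (k + 1 - i) : ℂ)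
    = (∑ i ∈ Finset.range k,
        x ^ (i + 1) * y ^ (k - i) * ((rz (i + 2) * rz (k + 1 - i) : ℝ) : ℂ))
      + (y ^ (k + 1) * ((rz (k + 3) + dz (k + 2) 1 : ℝ) : ℂ)
        + x ^ (k + 1) * ((rz (k + 3) + dz (k + 2) 1 : ℝ) : ℂ)) := by
  have hdz : ∀ i ∈ Finset.range (k + 1), HasSum (fun z : ℕ × ℕ =>
      (((z.1 + 1 : ℝ) + (z.2 + 1)) ^ (i + 2))⁻¹ * ((z.2 + 1 : ℝ) ^ (k + 1 - i))⁻¹)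
      (dz (i + 2) (k + 1 - i)) := fun i hi =>
    hasSum_dz (by omega) (by have := Finset.mem_range.1 hi; omega)
  have h₁ := hasSum_sum fun i hi =>
    (Complex.hasSum_ofReal.2 (hdz i hi)).mul_left ((x + y) ^ (i + 1) * y ^ (k - i))
  have h₂ := hasSum_sum fun i hi => (Complex.hasSum_ofReal.2
    ((Equiv.prodComm ℕ ℕ).hasSum_iff.2 (hdz i hi))).mul_left ((x + y) ^ (i + 1) * x ^ (k - i))
  have h₃ := hasSum_sum fun i (hi : i ∈ Finset.range k) => (Complex.hasSum_ofReal.2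
    (hasSum_inv_pow_mul_inv_pow (a := i + 2) (b := k + 1 - i) (by omega)
      (by have := Finset.mem_range.1 hi; omega))).mul_left (x ^ (i + 1) * y ^ (k - i))
  have h₄ := (Complex.hasSum_ofReal.2 (hasSum_inv_pow_mul_inv_sub_inv k)).mul_left (x ^ (k + 1))
  have h₅ := (Complex.hasSum_ofReal.2 ((Equiv.prodComm ℕ ℕ).hasSum_iff.2
    (hasSum_inv_pow_mul_inv_sub_inv k))).mul_left (y ^ (k + 1))
  refine (h₁.add h₂).unique ?_
  convert h₃.add (h₅.add h₄) using 2 with z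
  have hp : (z.1 + 1 : ℂ) ≠ 0 := Nat.cast_add_one_ne_zero _
  have hq : (z.2 + 1 : ℂ) ≠ 0 := Nat.cast_add_one_ne_zero _
  have hpq : (z.1 + 1 : ℂ) + (z.2 + 1) ≠ 0 := by
    have : ((z.1 + 1 + (z.2 + 1) : ℕ) : ℂ) ≠ 0 := Nat.cast_ne_zero.2 (by omega)
    exact_mod_cast this
  have h := shuffle_pointwise k x y hp hq hpq
  simp only [Function.comp_def, Equiv.prodComm_apply, Prod.fst_swap, Prod.snd_swap]
  push_cast
  rw [add_comm (z.2 + 1 : ℂ) (z.1 + 1)]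
  exact h

/-- The sum formula in depth two. -/
lemma sum_dz (k : ℕ) : ∑ i ∈ Finset.range (k + 1), dz (i + 2) (k + 1 - i) = rz (k + 3) := by
  have h := shuffle_sum k 1 0
  rw [Finset.sum_range_succ] at h
  have h₁ : ∀ c : ℕ → ℂ, ∑ i ∈ Finset.range k, ((1 + 0 : ℂ)) ^ (i + 1) * 0 ^ (k - i) * c i = 0 :=
    fun c => Finset.sum_eq_zero fun i hi => by
      have := Finset.mem_range.1 hi
      simp [show k - i ≠ 0 by omega]
  have h₂ : ∀ c : ℕ → ℂ, ∑ i ∈ Finset.range k, (1 : ℂ) ^ (i + 1) * 0 ^ (k - i) * c i = 0 :=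
    fun c => by simpa using h₁ c
  rw [h₁ fun i => (dz (i + 2) (k + 1 - i) : ℂ),
    h₂ fun i => ((rz (i + 2) * rz (k + 1 - i) : ℝ) : ℂ)] at h
  simp only [add_zero, one_pow, Nat.sub_self, pow_zero, one_mul, zero_add, ne_eq,
    Nat.add_eq_zero_iff, one_ne_zero, and_false, not_false_eq_true, zero_pow, zero_mul,
    Nat.add_sub_cancel_left] at h
  norm_cast at h
  linarith

/-- Euler's evaluation of `ζ(k + 2, 1)`. -/
lemma two_mul_dz_one (k : ℕ) :
    2 * dz (k + 2) 1 + ∑ i ∈ Finset.range k, rz (i + 2) * rz (k + 1 - i)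
      = (k + 2) * rz (k + 3) := by
  have h := sum_dz k
  rw [Finset.sum_range_succ, Nat.add_sub_cancel_left] at h
  have h₁ : ∑ i ∈ Finset.range k, rz (i + 2) * rz (k + 1 - i)
      = ∑ i ∈ Finset.range k, (dz (i + 2) (k + 1 - i) + dz (k + 1 - i) (i + 2) + rz (k + 3)) := by
    refine Finset.sum_congr rfl fun i hi => ?_
    have := Finset.mem_range.1 hi
    rw [rz_mul_rz (by omega) (by omega), show i + 2 + (k + 1 - i) = k + 3 by omega]
  have h₂ : ∑ i ∈ Finset.range k, dz (k + 1 - i) (i + 2)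
      = ∑ i ∈ Finset.range k, dz (i + 2) (k + 1 - i) := by
    rw [← Finset.sum_range_reflect]
    refine Finset.sum_congr rfl fun i hi => ?_
    have := Finset.mem_range.1 hi
    congr 1 <;> omega
  rw [h₁, Finset.sum_add_distrib, Finset.sum_add_distrib, h₂]
  simp only [Finset.sum_const, Finset.card_range, nsmul_eq_mul]
  linarith

/-- Strictly decreasing pairs of positive integers, parametrised by their gap and their minimum. -/
def gapEquiv : ℕ × ℕ ≃ {m : Fin 2 → ℕ // StrictAnti m ∧ ∀ i, 0 < m i} where
  toFun z := ⟨![z.1 + 1 + (z.2 + 1), z.2 + 1], by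
    refine ⟨?_, by simp [Fin.forall_fin_two]⟩
    rw [Fin.strictAnti_iff_succ_lt]
    simp⟩
  invFun m := (m.1 0 - m.1 1 - 1, m.1 1 - 1)
  left_inv z := by
    ext <;> simp
  right_inv m := by
    have h₁ : m.1 1 < m.1 0 := m.2.1 (by decide)
    have h₂ := m.2.2 1
    ext i
    fin_cases i <;> simp <;> omega

lemma mzv_pair (c : Fin 2 → ℕ) : mzv c = dz (c 0) (c 1) := by
  unfold mzv dz
  rw [← gapEquiv.tsum_eq]
  exact tsum_congr fun z => by simp [gapEquiv, Fin.prod_univ_two, mul_comm]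

lemma G_two (k : ℕ) (u v : ℂ) :
    G (k + 3) 2 u v
      = ∑ i ∈ Finset.range (k + 1), u ^ (i + 1) * v ^ (k - i) * (dz (i + 2) (k + 1 - i) : ℂ) := by
  unfold G
  symm
  refine Finset.sum_bij' (fun i _ => ![i + 2, k + 1 - i]) (fun c _ => c 0 - 2) ?_ ?_ ?_ ?_ ?_
  · intro i hi
    have := Finset.mem_range.1 hi
    simp [Finset.Nat.mem_antidiagonalTuple, Fin.forall_fin_two]
    omega
  · intro c hc
    simp [Finset.Nat.mem_antidiagonalTuple, Fin.forall_fin_two] at hc ⊢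
    omega
  · intro i hi
    simp
  · intro c hc
    simp [Finset.Nat.mem_antidiagonalTuple, Fin.forall_fin_two] at hc
    ext j
    fin_cases j <;> simp <;> omega
  · intro i hi
    have hik : k + 1 - i - 1 = k - i := by omega
    simp [mzv_pair, hik]

/-- Proposition 4.1 (i) of Machide: for `l ≥ 3`,
`G_l^2(x+y,y) + G_l^2(y+x,x)
  = ((l+1)/2)(x^(l-2) + y^(l-2)) ζ(l)
    - (1/2) Σ_{j₁,j₂≥2, j₁+j₂=l} (x^(j₁-1) - y^(j₁-1))(x^(j₂-1) - y^(j₂-1)) ζ(j₁)ζ(j₂)`,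
with `j₂ = l - j₁`. -/
theorem depth_two_identity (l : ℕ) (hl : 3 ≤ l) (x y : ℂ) :
    G l 2 (x + y) y + G l 2 (y + x) x
      = ((l : ℂ) + 1) / 2 * (x ^ (l - 2) + y ^ (l - 2)) * (rz l : ℂ)
        - (1 / 2) * ∑ j ∈ Finset.Icc 2 (l - 2),
            (x ^ (j - 1) - y ^ (j - 1)) * (x ^ (l - j - 1) - y ^ (l - j - 1))
              * (rz j : ℂ) * (rz (l - j) : ℂ) := by
  obtain ⟨k, rfl⟩ : ∃ k, l = k + 3 := ⟨l - 3, by omega⟩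
  rw [add_comm y x, G_two, G_two, shuffle_sum]
  have hsum : ∑ j ∈ Finset.Icc 2 (k + 3 - 2),
      (x ^ (j - 1) - y ^ (j - 1)) * (x ^ (k + 3 - j - 1) - y ^ (k + 3 - j - 1))
        * (rz j : ℂ) * (rz (k + 3 - j) : ℂ)
      = ∑ i ∈ Finset.range k, (x ^ (i + 1) - y ^ (i + 1)) * (x ^ (k - i) - y ^ (k - i))
        * ((rz (i + 2) * rz (k + 1 - i) : ℝ) : ℂ) := by
    rw [show Finset.Icc 2 (k + 3 - 2) = Finset.Ico 2 (k + 2) by ext; simp; omega,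
      Finset.sum_Ico_eq_sum_range, Nat.add_sub_cancel]
    refine Finset.sum_congr rfl fun i _ => ?_
    rw [add_comm 2 i, show k + 3 - (i + 2) - 1 = k - i by omega,
      show k + 3 - (i + 2) = k + 1 - i by omega, show i + 2 - 1 = i + 1 by omega]
    push_cast
    ring
  have hswap : ∑ i ∈ Finset.range k,
        y ^ (i + 1) * x ^ (k - i) * ((rz (i + 2) * rz (k + 1 - i) : ℝ) : ℂ)
      = ∑ i ∈ Finset.range k,
        x ^ (i + 1) * y ^ (k - i) * ((rz (i + 2) * rz (k + 1 - i) : ℝ) : ℂ) := by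
    rw [← Finset.sum_range_reflect]
    refine Finset.sum_congr rfl fun i hi => ?_
    have := Finset.mem_range.1 hi
    rw [show k - 1 - i + 1 = k - i by omega, show k - (k - 1 - i) = i + 1 by omega,
      show k - 1 - i + 2 = k + 1 - i by omega, show k + 1 - (k - 1 - i) = i + 2 by omega,
      mul_comm (rz _)]
    ring
  have hexpand : ∑ i ∈ Finset.range k, (x ^ (i + 1) - y ^ (i + 1)) * (x ^ (k - i) - y ^ (k - i))
        * ((rz (i + 2) * rz (k + 1 - i) : ℝ) : ℂ)
      = (x ^ (k + 1) + y ^ (k + 1)) * ((∑ i ∈ Finset.range k, rz (i + 2) * rz (k + 1 - i) : ℝ) : ℂ)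
        - 2 * ∑ i ∈ Finset.range k,
          x ^ (i + 1) * y ^ (k - i) * ((rz (i + 2) * rz (k + 1 - i) : ℝ) : ℂ) := by
    rw [two_mul]
    nth_rewrite 2 [← hswap]
    rw [Complex.ofReal_sum, Finset.mul_sum, ← Finset.sum_add_distrib, ← Finset.sum_sub_distrib]
    refine Finset.sum_congr rfl fun i hi => ?_
    have := Finset.mem_range.1 hi
    have hpow : ∀ w : ℂ, w ^ (k + 1) = w ^ (i + 1) * w ^ (k - i) := fun w => by
      rw [← pow_add]
      congr 1
      omega
    rw [hpow x, hpow y]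
    ring
  have heuler := congrArg (fun r : ℝ => (r : ℂ)) (two_mul_dz_one k)
  rw [hsum, hexpand, show k + 3 - 2 = k + 1 by omega]
  simp only [Complex.ofReal_add, Complex.ofReal_mul, Complex.ofReal_ofNat,
    Complex.ofReal_natCast] at heuler ⊢
  push_cast at heuler ⊢
  linear_combination (x ^ (k + 1) + y ^ (k + 1)) / 2 * heuler
end

section
/- For any integer l ≥ 4 and complex numbers x, y, one has G_l^3(x+y, y) − G_l^3(y+x, x) = ((l+1)(l−4)/6)(x^{l−3} − y^{l−3}) ζ(l) − (1/2) Σ_{j₁≥2, j₂≥3, j₁+j₂=l} (j₂−1)(x^{j₁−1} − y^{j₁−1})(x^{j₂−2} + y^{j₂−2}) ζ(j₁) ζ(j₂) + (1/6) Σ_{j₁,j₂,j₃≥2, j₁+j₂+j₃=l} Π_{i=1}^{3} (x^{j_i−1} − y^{j_i−1}) ζ(j_i). -/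
open scoped BigOperators

section

open Finset Filter Topology

section PartialSums

variable {R : Type*} [CommRing R]

/-- The partial sum `Σ_{i < n} f i`. -/
def psum (f : ℕ → R) (n : ℕ) : R := ∑ i ∈ range n, f i

/-- The nested partial sum `Σ_{j < i < n} f i * f j`. -/
def psum₂ (f : ℕ → R) (n : ℕ) : R := ∑ i ∈ range n, f i * psum f i

/-- The nested partial sum `Σ_{k < j < i < n} s i * f j * f k`. -/
def psum₃ (s f : ℕ → R) (n : ℕ) : R := ∑ i ∈ range n, s i * psum₂ f i

/-- The convolution `Σ_{i < n} f i * psum₂ g (n - 1 - i)`. -/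
def conv₂ (f g : ℕ → R) (n : ℕ) : R := ∑ i ∈ range n, f i * psum₂ g (n - 1 - i)

lemma psum_succ (f : ℕ → R) (n : ℕ) : psum f (n + 1) = psum f n + f n := sum_range_succ _ _

lemma psum₂_succ (f : ℕ → R) (n : ℕ) : psum₂ f (n + 1) = psum₂ f n + f n * psum f n :=
  sum_range_succ _ _

lemma psum₃_succ (s f : ℕ → R) (n : ℕ) : psum₃ s f (n + 1) = psum₃ s f n + s n * psum₂ f n :=
  sum_range_succ _ _

lemma two_mul_psum₂ (f : ℕ → R) (n : ℕ) :
    2 * psum₂ f n = psum f n ^ 2 - psum (fun i => f i ^ 2) n := by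
  induction n with
  | zero => simp [psum, psum₂]
  | succ n ih =>
    rw [psum₂_succ, psum_succ, psum_succ]
    linear_combination ih

lemma six_mul_psum₃ (f : ℕ → R) (n : ℕ) :
    6 * psum₃ f f n = psum f n ^ 3 - 3 * psum f n * psum (fun i => f i ^ 2) n
      + 2 * psum (fun i => f i ^ 3) n := by
  induction n with
  | zero => simp [psum, psum₃]
  | succ n ih =>
    rw [psum₃_succ, psum_succ, psum_succ, psum_succ]
    linear_combination ih + 3 * f n * two_mul_psum₂ f n

lemma psum_mul_psum₂_sub (f g : ℕ → R) (n : ℕ) :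
    6 * (psum f n * psum₂ g n - psum g n * psum₂ f n - psum₃ g g n + psum₃ f f n)
      = (psum f n - psum g n) ^ 3
        - 3 * ((psum f n - psum g n)
          * (psum (fun i => f i ^ 2) n + psum (fun i => g i ^ 2) n))
        + 2 * (psum (fun i => f i ^ 3) n - psum (fun i => g i ^ 3) n) := by
  linear_combination 3 * psum f n * two_mul_psum₂ g n - 3 * psum g n * two_mul_psum₂ f n
    - six_mul_psum₃ g n + six_mul_psum₃ f n

lemma sum_range_mul_psum (f g : ℕ → R) (n : ℕ) :
    ∑ i ∈ range (n + 1), f i * psum g (n - i)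
      = ∑ i ∈ range n, f i * psum g (n - 1 - i) + ∑ i ∈ range n, f i * g (n - 1 - i) := by
  rw [sum_range_succ, Nat.sub_self, ← sum_add_distrib]
  simp only [psum, range_zero, sum_empty, mul_zero, add_zero]
  refine sum_congr rfl fun i hi => ?_
  have : n - i = n - 1 - i + 1 := by have := mem_range.1 hi; omega
  rw [this, sum_range_succ]
  ring

lemma sum_range_mul_reflect_comm (f g : ℕ → R) (n : ℕ) :
    ∑ i ∈ range n, f i * g (n - 1 - i) = ∑ i ∈ range n, g i * f (n - 1 - i) := by
  rw [← sum_range_reflect]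
  refine sum_congr rfl fun i hi => ?_
  have : n - 1 - (n - 1 - i) = i := by have := mem_range.1 hi; omega
  rw [this, mul_comm]

lemma sum_range_mul_psum_comm (f g : ℕ → R) (n : ℕ) :
    ∑ i ∈ range n, f i * psum g (n - 1 - i) = ∑ i ∈ range n, g i * psum f (n - 1 - i) := by
  induction n with
  | zero => simp
  | succ n ih =>
    simp only [Nat.add_sub_cancel]
    rw [sum_range_mul_psum, sum_range_mul_psum, ih, sum_range_mul_reflect_comm f g]

/-- One step of the truncated shuffle product. -/
lemma conv₂_succ {f g s : ℕ → R} (h : ∀ i j, f i * g j = s (i + j + 1) * (f i + g j)) (n : ℕ) :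
    conv₂ f g (n + 1)
      = conv₂ f g n + s n * (∑ i ∈ range n, f i * psum g (n - 1 - i) + psum₂ g n) := by
  have h1 : psum₂ g n = ∑ i ∈ range n, g (n - 1 - i) * psum g (n - 1 - i) :=
    (sum_range_reflect (fun i => g i * psum g i) n).symm
  rw [conv₂, sum_range_succ, conv₂, h1, ← sum_add_distrib, mul_sum, ← sum_add_distrib]
  simp only [Nat.add_sub_cancel, Nat.sub_self]
  simp only [psum₂, range_zero, sum_empty, mul_zero, add_zero]
  refine sum_congr rfl fun i hi => ?_
  have hi := mem_range.1 hi
  obtain ⟨j, rfl⟩ : ∃ j, n = i + j + 1 := ⟨n - 1 - i, by omega⟩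
  have e1 : i + j + 1 - i = j + 1 := by omega
  have e2 : i + j + 1 - 1 - i = j := by omega
  rw [e1, e2, sum_range_succ]
  linear_combination psum g j * h i j

lemma conv₂_sub_conv₂ {f g s : ℕ → R} (h : ∀ i j, f i * g j = s (i + j + 1) * (f i + g j))
    (n : ℕ) : conv₂ f g n - conv₂ g f n = psum₃ s g n - psum₃ s f n := by
  have h' : ∀ i j, g i * f j = s (i + j + 1) * (g i + f j) := fun i j => by
    rw [mul_comm, h, add_comm j i, add_comm (f j)]
  induction n with
  | zero => simp [conv₂, psum₃]
  | succ n ih =>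
    rw [conv₂_succ h, conv₂_succ h', psum₃_succ, psum₃_succ, sum_range_mul_psum_comm g f]
    linear_combination ih

end PartialSums

section SumFormula

variable {R : Type*} [CommRing R]

/-- The connector `Π_{i < n} d i * ρ (m + i)`. -/
def connector (d ρ : ℕ → R) (n m : ℕ) : R := ∏ i ∈ range n, d i * ρ (m + i)

variable {d ρ : ℕ → R}

lemma connector_succ (n m : ℕ) :
    connector d ρ (n + 1) m = connector d ρ n m * (d n * ρ (m + n)) := prod_range_succ _ _

lemma connector_mul_eq (n m : ℕ) :
    connector d ρ n m * ρ (m + n) = connector d ρ n (m + 1) * ρ m := by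
  induction n with
  | zero => simp [connector]
  | succ n ih =>
    rw [connector_succ, connector_succ, show m + (n + 1) = m + 1 + n by omega]
    linear_combination d n * ρ (m + 1 + n) * ih

variable (hd : ∀ i j : ℕ, d (i + j) = d i + j) (hρ : ∀ i, d (i + 1) * ρ (i + 1) = 1)

include hρ in
lemma connector_one (n : ℕ) : connector d ρ (n + 1) 1 = d 0 * ρ (n + 1) := by
  induction n with
  | zero => simp [connector]
  | succ n ih =>
    rw [connector_succ, ih, show 1 + (n + 1) = n + 1 + 1 by omega]
    linear_combination d 0 * ρ (n + 1 + 1) * hρ n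

include hd hρ in
lemma mul_connector_eq_sub_right (n m : ℕ) :
    n * (connector d ρ n (m + 1) * ρ (m + 1 + n))
      = connector d ρ n (m + 1) - connector d ρ n (m + 2) := by
  have h1 := hρ (m + n)
  rw [show m + n + 1 = m + 1 + n by omega, hd] at h1
  have h2 := connector_mul_eq (d := d) (ρ := ρ) n (m + 1)
  linear_combination connector d ρ n (m + 1) * h1 - d (m + 1) * h2
    - connector d ρ n (m + 2) * hρ m

include hd hρ in
lemma mul_connector_eq_sub_left (n m : ℕ) :
    (m + 1 : ℕ) * (connector d ρ n (m + 1) * ρ (m + 1 + n))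
      = connector d ρ n (m + 1) - connector d ρ (n + 1) (m + 1) := by
  have h1 := hρ (m + n)
  rw [show m + n + 1 = n + (m + 1) by omega, hd] at h1
  rw [connector_succ, show m + 1 + n = n + (m + 1) by omega]
  linear_combination connector d ρ n (m + 1) * h1

include hd hρ in
lemma mul_sum_connector (f g : ℕ → R) (hf : f 0 = 0)
    (hfg : ∀ k, f (k + 1) = f k + ρ (k + 1) * g k) (m N : ℕ) :
    (m + 1 : ℕ) * ∑ k ∈ range N, connector d ρ (k + 1) (m + 1) * ρ (m + 1 + (k + 1)) * f k
      = ∑ k ∈ range N, connector d ρ (k + 1) (m + 1) * ρ (m + 1 + (k + 1)) * g k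
        - connector d ρ (N + 1) (m + 1) * f N := by
  induction N with
  | zero => simp [hf]
  | succ N ih =>
    rw [sum_range_succ, sum_range_succ, hfg N]
    have h := mul_connector_eq_sub_left hd hρ (N + 1) m
    have h2 := connector_succ (d := d) (ρ := ρ) (N + 1) (m + 1)
    linear_combination ih + f N * h + ρ (N + 1) * g N * h2
      + connector d ρ (N + 1) (m + 1) * ρ (m + 1 + (N + 1)) * g N * hρ N

include hd hρ in
lemma mul_sum_connector_one (m N : ℕ) :
    (m + 1 : ℕ) * ∑ k ∈ range N, connector d ρ (k + 1) (m + 1) * ρ (m + 1 + (k + 1))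
      = d 0 * ρ (m + 1) - connector d ρ (N + 1) (m + 1) := by
  induction N with
  | zero => simp [connector]
  | succ N ih =>
    rw [sum_range_succ]
    linear_combination ih + mul_connector_eq_sub_left hd hρ (N + 1) m

include hd hρ in
lemma sum_connector_psum₂ {u : ℕ → R} (hu : ∀ k : ℕ, ((k + 1 : ℕ) : R) * u k = 1) (m N : ℕ) :
    ∑ k ∈ range N, connector d ρ (k + 1) (m + 1) * ρ (m + 1 + (k + 1))
        * psum₂ (fun i => ρ (i + 1)) k
      = u m ^ 3 * (d 0 * ρ (m + 1)) - connector d ρ (N + 1) (m + 1)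
        * (u m ^ 3 + u m ^ 2 * psum (fun i => ρ (i + 1)) N
          + u m * psum₂ (fun i => ρ (i + 1)) N) := by
  have h2 := mul_sum_connector hd hρ (psum₂ fun i => ρ (i + 1)) (psum fun i => ρ (i + 1))
    (by simp [psum₂]) (fun k => psum₂_succ _ _) m N
  have h1 := mul_sum_connector hd hρ (psum fun i => ρ (i + 1)) (fun _ => 1)
    (by simp [psum]) (fun k => by rw [psum_succ, mul_one]) m N
  simp only [mul_one] at h1
  have h0 := mul_sum_connector_one hd hρ m N
  have e2 : ∀ {a b : R}, ((m + 1 : ℕ) : R) * a = b → a = u m * b := fun {a b} h => by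
    linear_combination u m * h - a * hu m
  rw [e2 h2, e2 h1, e2 h0]
  ring

include hd hρ in
/-- The truncated sum formula in depth three, with explicit remainder. -/
lemma psum₃_sub_psum₃ {u : ℕ → R} (hu : ∀ k : ℕ, ((k + 1 : ℕ) : R) * u k = 1) (N : ℕ) :
    psum₃ u (fun i => ρ (i + 1)) N - psum₃ (fun i => ρ (i + 1)) (fun i => ρ (i + 1)) N
      = d 0 * ∑ m ∈ range N, u m ^ 3 * ρ (m + 1)
        - ∑ m ∈ range N, connector d ρ (N + 1) (m + 1)
          * (u m ^ 3 + u m ^ 2 * psum (fun i => ρ (i + 1)) N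
            + u m * psum₂ (fun i => ρ (i + 1)) N)
        + ∑ k ∈ range N, u k * connector d ρ (k + 1) (N + 1)
          * psum₂ (fun i => ρ (i + 1)) k := by
  have key : ∀ k, u k - ρ (k + 1)
      = ∑ m ∈ range N, connector d ρ (k + 1) (m + 1) * ρ (m + 1 + (k + 1))
        + u k * connector d ρ (k + 1) (N + 1) := by
    intro k
    have h1 : ((k + 1 : ℕ) : R) * ∑ m ∈ range N, connector d ρ (k + 1) (m + 1)
        * ρ (m + 1 + (k + 1)) = connector d ρ (k + 1) 1 - connector d ρ (k + 1) (N + 1) := by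
      rw [mul_sum, ← sum_range_sub' (fun m => connector d ρ (k + 1) (m + 1))]
      exact sum_congr rfl fun m _ => mul_connector_eq_sub_right hd hρ (k + 1) m
    rw [connector_one hρ] at h1
    have h2 := hρ k
    have h3 := hd 0 (k + 1)
    rw [zero_add] at h3
    rw [h3] at h2
    linear_combination (∑ m ∈ range N, connector d ρ (k + 1) (m + 1)
        * ρ (m + 1 + (k + 1)) + ρ (k + 1)) * hu k - u k * h1 - u k * h2
  rw [psum₃, psum₃, ← sum_sub_distrib, mul_sum, ← sum_sub_distrib]
  have : ∀ m ∈ range N, d 0 * (u m ^ 3 * ρ (m + 1)) - connector d ρ (N + 1) (m + 1)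
      * (u m ^ 3 + u m ^ 2 * psum (fun i => ρ (i + 1)) N
          + u m * psum₂ (fun i => ρ (i + 1)) N)
      = ∑ k ∈ range N, connector d ρ (k + 1) (m + 1) * ρ (m + 1 + (k + 1))
        * psum₂ (fun i => ρ (i + 1)) k := fun m _ => by
    rw [sum_connector_psum₂ hd hρ hu]
    ring
  rw [sum_congr rfl this, sum_comm, ← sum_add_distrib]
  refine sum_congr rfl fun k _ => ?_
  rw [← sub_mul, key k, add_mul, sum_mul]

end SumFormula

section ConvRemainder

variable {R : Type*} [CommRing R]

/-- The pairs `(i, j)` with `i, j < n` and `n ≤ i + j + 1`. -/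
def upperPairs (n : ℕ) : Finset (ℕ × ℕ) :=
  (range n ×ˢ range n).filter fun p => n ≤ p.1 + p.2 + 1

lemma sum_upperPairs {M : Type*} [AddCommMonoid M] (n : ℕ) (F : ℕ → ℕ → M) :
    ∑ p ∈ upperPairs n, F p.1 p.2 = ∑ i ∈ range n, ∑ j ∈ Ico (n - 1 - i) n, F i j := by
  rw [upperPairs, sum_filter, sum_product]
  refine sum_congr rfl fun i hi => ?_
  rw [← sum_filter]
  refine sum_congr ?_ fun _ _ => rfl
  ext j
  have := mem_range.1 hi
  simp only [mem_filter, mem_range, mem_Ico]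
  omega

lemma sum_upperPairs_comm {M : Type*} [AddCommMonoid M] (n : ℕ) (F : ℕ → ℕ → M) :
    ∑ p ∈ upperPairs n, F p.1 p.2 = ∑ p ∈ upperPairs n, F p.2 p.1 := by
  refine sum_nbij' Prod.swap Prod.swap ?_ ?_ ?_ ?_ ?_ <;>
    simp [upperPairs] <;> omega

lemma psum_mul_psum₂_sub_conv₂ (f g : ℕ → R) (n : ℕ) :
    psum f n * psum₂ g n - conv₂ f g n
      = ∑ p ∈ upperPairs n, f p.1 * (g p.2 * psum g p.2) := by
  rw [sum_upperPairs n fun i j => f i * (g j * psum g j), psum, conv₂, sum_mul,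
    ← sum_sub_distrib]
  refine sum_congr rfl fun i hi => ?_
  rw [← mul_sum, ← mul_sub, sum_Ico_eq_sub _ (by omega : n - 1 - i ≤ n)]
  rfl

lemma sum_upperPairs_mul (f g s : ℕ → R)
    (h : ∀ i j, f i * g j = s (i + j + 1) * (f i + g j)) (n : ℕ) :
    ∑ p ∈ upperPairs n, f p.1 * g p.2 = psum f n * psum g n
      - ∑ k ∈ range n, s k * (psum f k + psum g k) := by
  rw [sum_upperPairs n fun i j => f i * g j]
  have h1 : ∀ i ∈ range n, ∑ j ∈ Ico (n - 1 - i) n, f i * g j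
      = f i * psum g n - f i * psum g (n - 1 - i) := fun i _ => by
    rw [← mul_sum, ← mul_sub, sum_Ico_eq_sub _ (by omega : n - 1 - i ≤ n)]
    rfl
  rw [sum_congr rfl h1, sum_sub_distrib, ← sum_mul]
  congr 1
  clear h1
  induction n with
  | zero => simp
  | succ n ih =>
    rw [sum_range_succ (fun k => s k * (psum f k + psum g k)), ← ih]
    simp only [Nat.add_sub_cancel]
    rw [sum_range_mul_psum]
    congr 1
    rw [psum, psum, ← sum_range_reflect g, ← sum_add_distrib, mul_sum]
    refine sum_congr rfl fun i hi => ?_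
    obtain ⟨j, rfl⟩ : ∃ j, n = i + j + 1 := ⟨n - 1 - i, by have := mem_range.1 hi; omega⟩
    rw [show i + j + 1 - 1 - i = j by omega, h]

lemma sum_upperPairs_mul_self (u : ℕ → R)
    (h : ∀ i j, u i * u j = u (i + j + 1) * (u i + u j)) (n : ℕ) :
    ∑ p ∈ upperPairs n, u p.1 * u p.2 = psum (fun i => u i ^ 2) n := by
  have h1 := sum_upperPairs_mul u u u h n
  have h2 : ∑ k ∈ range n, u k * (psum u k + psum u k) = 2 * psum₂ u n := by
    rw [psum₂, mul_sum]
    exact sum_congr rfl fun _ _ => by ring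
  rw [h1, h2]
  linear_combination -two_mul_psum₂ u n

/-- The remainder of `psum f n * psum₂ g n - conv₂ f g n` after removal of its main terms. -/
def convRem (u f g : ℕ → R) (n : ℕ) : R :=
  ∑ p ∈ upperPairs n, ((f p.1 * g p.2 - u p.1 * u p.2) * psum g p.2
    - u p.1 * u p.2 * ∑ k ∈ Ico p.2 n, (g k - u k))

lemma psum_mul_psum₂_sub_conv₂_eq {u : ℕ → R}
    (h : ∀ i j, u i * u j = u (i + j + 1) * (u i + u j)) (f g : ℕ → R) (n : ℕ) :
    psum f n * psum₂ g n - conv₂ f g n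
      = ∑ p ∈ upperPairs n, u p.1 * u p.2 * psum u p.2
        + psum (fun i => u i ^ 2) n * (psum g n - psum u n) + convRem u f g n := by
  rw [psum_mul_psum₂_sub_conv₂, ← sum_upperPairs_mul_self u h, convRem, sum_mul,
    ← sum_add_distrib, ← sum_add_distrib]
  refine sum_congr rfl fun p hp => ?_
  have hp : p.2 ≤ n := by simp [upperPairs] at hp; omega
  rw [sum_Ico_eq_sub _ hp, sum_sub_distrib, sum_sub_distrib]
  simp only [psum]
  ring

/-- The antisymmetrised convolution up to remainder. -/
lemma conv₂_sub_conv₂_eq {u : ℕ → R}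
    (h : ∀ i j, u i * u j = u (i + j + 1) * (u i + u j)) (f g : ℕ → R) (n : ℕ) :
    conv₂ f g n - conv₂ g f n
      = psum f n * psum₂ g n - psum g n * psum₂ f n
        + psum (fun i => u i ^ 2) n * (psum f n - psum g n)
        - convRem u f g n + convRem u g f n := by
  linear_combination psum_mul_psum₂_sub_conv₂_eq h g f n - psum_mul_psum₂_sub_conv₂_eq h f g n

end ConvRemainder

section Estimates

/-- One plus the `n`-th harmonic number. -/
noncomputable def har (n : ℕ) : ℝ := 1 + ∑ i ∈ range n, 1 / ((i : ℝ) + 1)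

lemma har_mono : Monotone har := fun _ _ h =>
  add_le_add_right (sum_le_sum_of_subset_of_nonneg (range_mono h) fun _ _ _ => by positivity) _

lemma one_le_har (n : ℕ) : 1 ≤ har n :=
  le_add_of_nonneg_right (sum_nonneg fun _ _ => by positivity)

lemma sum_one_div_le_har (n : ℕ) : ∑ i ∈ range n, 1 / ((i : ℝ) + 1) ≤ har n := by
  rw [har]; linarith

lemma har_le (n : ℕ) : har n ≤ 10 * ((n : ℝ) + 1) ^ (1 / 8 : ℝ) := by
  have h1 : har n ≤ 2 + Real.log (n + 1) := by
    have h := harmonic_le_one_add_log n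
    have h2 : ((harmonic n : ℚ) : ℝ) = ∑ i ∈ range n, 1 / ((i : ℝ) + 1) := by
      simp [harmonic]
    have h3 : Real.log n ≤ Real.log (n + 1) := by
      rcases Nat.eq_zero_or_pos n with rfl | hn
      · simp
      · exact Real.log_le_log (by exact_mod_cast hn) (by linarith)
    rw [h2] at h
    rw [har]
    linarith
  have h2 := Real.log_le_rpow_div (x := (n : ℝ) + 1) (ε := 1 / 8) (by positivity) (by norm_num)
  have h3 : 1 ≤ ((n : ℝ) + 1) ^ (1 / 8 : ℝ) := Real.one_le_rpow (by simp) (by norm_num)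
  linarith

lemma tendsto_har_pow_div_sqrt :
    Tendsto (fun n : ℕ => har n ^ 3 / √((n : ℝ) + 1)) atTop (𝓝 0) := by
  have h0 : Tendsto (fun n : ℕ => ((n : ℝ) + 1) ^ (1 / 8 : ℝ)) atTop atTop :=
    (tendsto_rpow_atTop (by norm_num)).comp
      (tendsto_atTop_add_const_right _ _ tendsto_natCast_atTop_atTop)
  refine squeeze_zero (fun n => ?_) (fun n => ?_) ((tendsto_const_nhds (x := (1000 : ℝ))).div_atTop h0)
  · have := one_le_har n
    positivity
  · set t := ((n : ℝ) + 1) ^ (1 / 8 : ℝ) with ht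
    have ht0 : 0 < t := by positivity
    have hs : √((n : ℝ) + 1) = t ^ 4 := by
      rw [ht, Real.sqrt_eq_rpow, ← Real.rpow_natCast, ← Real.rpow_mul (by positivity)]
      norm_num
    have h1 : har n ^ 3 ≤ (10 * t) ^ 3 :=
      pow_le_pow_left₀ (by linarith [one_le_har n]) (har_le n) 3
    rw [hs, div_le_div_iff₀ (by positivity) ht0]
    nlinarith

lemma tendsto_of_le_har {c : ℝ} {a : ℕ → ℝ} (h0 : ∀ n, 0 ≤ a n)
    (h : ∀ n, a n ≤ c * (har n ^ 3 / √((n : ℝ) + 1))) : Tendsto a atTop (𝓝 0) :=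
  squeeze_zero h0 h (by simpa using tendsto_har_pow_div_sqrt.const_mul c)

lemma one_div_le_one_div_sqrt (n : ℕ) : 1 / ((n : ℝ) + 1) ≤ 1 / √((n : ℝ) + 1) := by
  have h1 : (1 : ℝ) ≤ √((n : ℝ) + 1) := Real.one_le_sqrt.2 (by simp)
  have h2 := Real.mul_self_sqrt (show (0 : ℝ) ≤ (n : ℝ) + 1 by positivity)
  exact one_div_le_one_div_of_le (by positivity) (by nlinarith)

lemma sum_upperPairs_le (n : ℕ) :
    ∑ p ∈ upperPairs n, 1 / (((p.1 : ℝ) + 1) ^ 2 * ((p.2 : ℝ) + 1))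
      ≤ 2 * har n / ((n : ℝ) + 1) := by
  rw [sum_upperPairs n fun i j => 1 / (((i : ℝ) + 1) ^ 2 * ((j : ℝ) + 1))]
  have h1 : ∀ i ∈ range n, ∑ j ∈ Ico (n - 1 - i) n, 1 / (((i : ℝ) + 1) ^ 2 * ((j : ℝ) + 1))
      ≤ (1 / ((i : ℝ) + 1) + 1 / (((n - 1 - i : ℕ) : ℝ) + 1)) / ((n : ℝ) + 1) := by
    intro i hi
    have hi := mem_range.1 hi
    obtain ⟨k, rfl⟩ : ∃ k, n = i + k + 1 := ⟨n - 1 - i, by omega⟩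
    rw [show i + k + 1 - 1 - i = k by omega]
    have h2 : ∀ j ∈ Ico k (i + k + 1), 1 / (((i : ℝ) + 1) ^ 2 * ((j : ℝ) + 1))
        ≤ 1 / (((i : ℝ) + 1) ^ 2 * ((k : ℝ) + 1)) := fun j hj => by
      have : (k : ℝ) ≤ j := by exact_mod_cast (mem_Ico.1 hj).1
      gcongr
    refine (sum_le_card_nsmul _ _ _ h2).trans (le_of_eq ?_)
    rw [Nat.card_Ico, show i + k + 1 - k = i + 1 by omega, nsmul_eq_mul]
    push_cast
    field_simp
    ring
  refine (sum_le_sum h1).trans ?_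
  rw [← sum_div, sum_add_distrib, sum_range_reflect (fun i : ℕ => 1 / ((i : ℝ) + 1))]
  have := sum_one_div_le_har n
  gcongr
  linarith

lemma sum_upperPairs_le' (n : ℕ) :
    ∑ p ∈ upperPairs n, 1 / (((p.1 : ℝ) + 1) * ((p.2 : ℝ) + 1) ^ 2)
      ≤ 2 * har n / ((n : ℝ) + 1) := by
  rw [sum_upperPairs_comm n fun i j => 1 / (((i : ℝ) + 1) * ((j : ℝ) + 1) ^ 2)]
  simpa only [mul_comm] using sum_upperPairs_le n

lemma sum_Ico_one_div_sq_le (j n : ℕ) :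
    ∑ k ∈ Ico j n, 1 / ((k : ℝ) + 1) ^ 2 ≤ 2 / ((j : ℝ) + 1) := by
  rcases le_total n j with h | h
  · rw [Ico_eq_empty_of_le h, sum_empty]
    positivity
  · suffices ∑ k ∈ Ico j n, 1 / ((k : ℝ) + 1) ^ 2
        ≤ 1 / ((j : ℝ) + 1 / 2) - 1 / ((n : ℝ) + 1 / 2) by
      have h1 : 0 ≤ 1 / ((n : ℝ) + 1 / 2) := by positivity
      have h2 : 1 / ((j : ℝ) + 1 / 2) ≤ 2 / ((j : ℝ) + 1) := by
        rw [div_le_div_iff₀ (by positivity) (by positivity)]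
        linarith
      linarith
    induction n, h using Nat.le_induction with
    | base => simp
    | succ n hn ih =>
      rw [sum_Ico_succ_top hn]
      have h1 : 1 / ((n : ℝ) + 1) ^ 2
          ≤ 1 / ((n : ℝ) + 1 / 2) - 1 / (((n + 1 : ℕ) : ℝ) + 1 / 2) := by
        push_cast
        rw [div_sub_div _ _ (by positivity) (by positivity),
          div_le_div_iff₀ (by positivity) (by positivity)]
        nlinarith
      linarith

variable {R : Type*} [CommRing R] (N : RingSeminorm R)

lemma RingSeminorm.sum_le {ι : Type*} (s : Finset ι) (f : ι → R) :
    N (∑ i ∈ s, f i) ≤ ∑ i ∈ s, N (f i) :=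
  le_sum_of_subadditive N (map_zero N).le (map_add_le_add N) s f

lemma seminorm_psum_le {f : ℕ → R} (hf : ∀ i : ℕ, N (f i) ≤ 2 / ((i : ℝ) + 1)) (n : ℕ) :
    N (psum f n) ≤ 2 * har n := by
  refine (N.sum_le _ _).trans ((sum_le_sum fun i _ => hf i).trans ?_)
  simp_rw [div_eq_mul_one_div (2 : ℝ)]
  rw [← mul_sum]
  exact mul_le_mul_of_nonneg_left (sum_one_div_le_har n) two_pos.le

lemma seminorm_psum₂_le {f : ℕ → R} (hf : ∀ i : ℕ, N (f i) ≤ 2 / ((i : ℝ) + 1)) (n : ℕ) :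
    N (psum₂ f n) ≤ 4 * har n ^ 2 := by
  have h : ∀ i ∈ range n, N (f i * psum f i) ≤ 4 * har n * (1 / ((i : ℝ) + 1)) := fun i hi => by
    have h1 := seminorm_psum_le N hf i
    have h2 := har_mono (mem_range.1 hi).le
    calc N (f i * psum f i) ≤ N (f i) * N (psum f i) := map_mul_le_mul N _ _
      _ ≤ 2 / ((i : ℝ) + 1) * (2 * har n) :=
        mul_le_mul (hf i) (by linarith) (apply_nonneg N _) (by positivity)
      _ = _ := by ring
  refine (N.sum_le _ _).trans ((sum_le_sum h).trans ?_)
  rw [← mul_sum]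
  have := sum_one_div_le_har n
  have := one_le_har n
  nlinarith

lemma seminorm_convRem_le {u f g : ℕ → R}
    (hg : ∀ i : ℕ, N (g i) ≤ 2 / ((i : ℝ) + 1)) (hu : ∀ i : ℕ, N (u i) ≤ 2 / ((i : ℝ) + 1))
    (hfu : ∀ i : ℕ, N (f i - u i) ≤ 2 / ((i : ℝ) + 1) ^ 2)
    (hgu : ∀ i : ℕ, N (g i - u i) ≤ 2 / ((i : ℝ) + 1) ^ 2) (n : ℕ) :
    N (convRem u f g n) ≤ 96 * (har n ^ 3 / √((n : ℝ) + 1)) := by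
  have hH := one_le_har n
  have key : ∀ p ∈ upperPairs n, N ((f p.1 * g p.2 - u p.1 * u p.2) * psum g p.2
      - u p.1 * u p.2 * ∑ k ∈ Ico p.2 n, (g k - u k))
      ≤ 24 * har n * (1 / (((p.1 : ℝ) + 1) ^ 2 * ((p.2 : ℝ) + 1))
        + 1 / (((p.1 : ℝ) + 1) * ((p.2 : ℝ) + 1) ^ 2)) := by
    rintro ⟨i, j⟩ hp
    have hj : j ≤ n := by simp [upperPairs] at hp; omega
    simp only
    have h1 : N (psum g j) ≤ 2 * har n :=
      (seminorm_psum_le N hg j).trans (by linarith [har_mono hj])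
    have h2 : N (∑ k ∈ Ico j n, (g k - u k)) ≤ 4 / ((j : ℝ) + 1) := by
      refine (N.sum_le _ _).trans ((sum_le_sum fun k _ => hgu k).trans ?_)
      have := sum_Ico_one_div_sq_le j n
      simp_rw [div_eq_mul_one_div (2 : ℝ)]
      rw [← mul_sum]
      calc _ ≤ 2 * (2 / ((j : ℝ) + 1)) := by gcongr
        _ = _ := by ring
    have h3 : N (f i * g j - u i * u j) ≤ 2 / ((i : ℝ) + 1) ^ 2 * (2 / ((j : ℝ) + 1))
        + 2 / ((i : ℝ) + 1) * (2 / ((j : ℝ) + 1) ^ 2) := by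
      rw [show f i * g j - u i * u j = (f i - u i) * g j + u i * (g j - u j) by ring]
      refine (map_add_le_add N _ _).trans (add_le_add ?_ ?_)
      · exact (map_mul_le_mul N _ _).trans
          (mul_le_mul (hfu i) (hg j) (apply_nonneg N _) (by positivity))
      · exact (map_mul_le_mul N _ _).trans
          (mul_le_mul (hu i) (hgu j) (apply_nonneg N _) (by positivity))
    have h4 : N (u i * u j) ≤ 2 / ((i : ℝ) + 1) * (2 / ((j : ℝ) + 1)) :=
      (map_mul_le_mul N _ _).trans (mul_le_mul (hu i) (hu j) (apply_nonneg N _) (by positivity))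
    refine (map_sub_le_add N _ _).trans ?_
    have h5 := (map_mul_le_mul N (f i * g j - u i * u j) (psum g j)).trans
      (mul_le_mul h3 h1 (apply_nonneg N _) (by positivity))
    have h6 := (map_mul_le_mul N (u i * u j) (∑ k ∈ Ico j n, (g k - u k))).trans
      (mul_le_mul h4 h2 (apply_nonneg N _) (by positivity))
    refine (add_le_add h5 h6).trans ?_
    set A := 1 / (((i : ℝ) + 1) ^ 2 * ((j : ℝ) + 1)) with hA
    set B := 1 / (((i : ℝ) + 1) * ((j : ℝ) + 1) ^ 2) with hB
    have hA0 : 0 ≤ A := by positivity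
    have hB0 : 0 ≤ B := by positivity
    calc _ = 8 * har n * A + 8 * har n * B + 16 * B := by
          rw [hA, hB]; field_simp; ring
      _ ≤ _ := by nlinarith [mul_nonneg (sub_nonneg.2 hH) hA0, mul_nonneg (sub_nonneg.2 hH) hB0]
  refine (N.sum_le _ _).trans ((sum_le_sum key).trans ?_)
  rw [← mul_sum, sum_add_distrib]
  have h1 := sum_upperPairs_le n
  have h2 := sum_upperPairs_le' n
  calc _ ≤ 24 * har n * (2 * har n / ((n : ℝ) + 1) + 2 * har n / ((n : ℝ) + 1)) := by gcongr
    _ = 96 * (har n ^ 2 * (1 / ((n : ℝ) + 1))) := by ring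
    _ ≤ 96 * (har n ^ 3 * (1 / √((n : ℝ) + 1))) := by
      have := one_div_le_one_div_sqrt n
      gcongr
      norm_num
    _ = _ := by ring

section Connector

variable {N} {d ρ : ℕ → R} (hd : ∀ i : ℕ, N (d i) ≤ (i : ℝ) + 1 / 4)
  (hρ : ∀ i : ℕ, N (ρ (i + 1)) ≤ 1 / ((i : ℝ) + 3 / 4))

include hd hρ in
lemma seminorm_mul_le (n m : ℕ) :
    N (d n * ρ (m + 1 + n)) ≤ ((n : ℝ) + 1 / 4) / ((m : ℝ) + n + 3 / 4) := by
  have h := hρ (m + n)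
  rw [show m + n + 1 = m + 1 + n by omega] at h
  push_cast at h
  rw [div_eq_mul_one_div]
  exact (map_mul_le_mul N _ _).trans (mul_le_mul (hd n) h (apply_nonneg N _) (by positivity))

include hd hρ in
lemma seminorm_connector_one_le (m : ℕ) :
    N (connector d ρ 1 (m + 1)) ≤ 1 / ((m : ℝ) + 1) := by
  have h := seminorm_mul_le hd hρ 0 m
  simp only [connector, range_one, prod_singleton]
  refine h.trans ?_
  rw [div_le_div_iff₀ (by positivity) (by positivity)]
  push_cast
  have : (0 : ℝ) ≤ m := by positivity
  linarith

include hd hρ in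
lemma seminorm_connector_le (n m : ℕ) :
    N (connector d ρ (n + 1) (m + 1)) ≤ 1 / ((m : ℝ) + 1) := by
  induction n with
  | zero => exact seminorm_connector_one_le hd hρ m
  | succ n ih =>
    rw [connector_succ]
    refine (map_mul_le_mul N _ _).trans ?_
    have h := seminorm_mul_le hd hρ (n + 1) m
    have h1 : (((n + 1 : ℕ) : ℝ) + 1 / 4) / ((m : ℝ) + (n + 1 : ℕ) + 3 / 4) ≤ 1 :=
      (div_le_one (by positivity)).2 (by have : (0 : ℝ) ≤ m := by positivity
                                         linarith)
    exact (mul_le_mul ih (h.trans h1) (apply_nonneg N _) (by positivity)).trans_eq (mul_one _)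

include hd hρ in
lemma seminorm_connector_le_sqrt (n m : ℕ) :
    N (connector d ρ (n + 1) (m + 1)) ≤ 2 / √((n : ℝ) + 1) * (1 / ((m : ℝ) + 1)) := by
  suffices N (connector d ρ (n + 1) (m + 1)) ≤ 2 / √((n : ℝ) + 5 / 4) * (1 / ((m : ℝ) + 1)) by
    refine this.trans ?_
    gcongr
    norm_num
  induction n with
  | zero =>
    refine (seminorm_connector_one_le hd hρ m).trans (le_mul_of_one_le_left (by positivity) ?_)
    rw [one_le_div (by positivity)]
    exact Real.sqrt_le_iff.2 (by norm_num)
  | succ n ih =>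
    rw [connector_succ]
    refine (map_mul_le_mul N _ _).trans ?_
    refine (mul_le_mul ih (seminorm_mul_le hd hρ (n + 1) m) (apply_nonneg N _)
      (by positivity)).trans ?_
    push_cast
    rw [mul_right_comm]
    gcongr
    set a := √((n : ℝ) + 5 / 4) with ha
    set b := √((n : ℝ) + 1 + 5 / 4) with hb
    have ha0 : 0 < a := by positivity
    have hb0 : 0 < b := by positivity
    have ha2 : a ^ 2 = (n : ℝ) + 5 / 4 := Real.sq_sqrt (by positivity)
    have hb2 : b ^ 2 = (n : ℝ) + 1 + 5 / 4 := Real.sq_sqrt (by positivity)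
    have hm : (0 : ℝ) ≤ m := by positivity
    rw [show (n : ℝ) + 1 + 1 / 4 = a ^ 2 by rw [ha2]; ring, div_mul_div_comm,
      div_le_div_iff₀ (by positivity) hb0]
    have h1 : a * b ≤ (m : ℝ) + (n + 1) + 3 / 4 := by nlinarith [sq_nonneg (a - b)]
    nlinarith [mul_le_mul_of_nonneg_left h1 ha0.le]

include hd hρ in
lemma seminorm_sumFormula_rem_le {u : ℕ → R} (hu : ∀ i : ℕ, N (u i) ≤ 1 / ((i : ℝ) + 1))
    (n : ℕ) :
    N (∑ k ∈ range n, u k * connector d ρ (k + 1) (n + 1) * psum₂ (fun i => ρ (i + 1)) k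
        - ∑ m ∈ range n, connector d ρ (n + 1) (m + 1)
          * (u m ^ 3 + u m ^ 2 * psum (fun i => ρ (i + 1)) n
            + u m * psum₂ (fun i => ρ (i + 1)) n))
      ≤ 18 * (har n ^ 3 / √((n : ℝ) + 1)) := by
  have hH := one_le_har n
  have hf : ∀ i : ℕ, N (ρ (i + 1)) ≤ 2 / ((i : ℝ) + 1) := fun i => (hρ i).trans (by
    rw [div_le_div_iff₀ (by positivity) (by positivity)]
    have : (0 : ℝ) ≤ i := by positivity
    linarith)
  have hu1 : ∀ i : ℕ, N (u i) ≤ 1 := fun i => (hu i).trans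
    ((div_le_one (by positivity)).2 (by simp))
  have h1 : ∀ k ∈ range n, N (u k * connector d ρ (k + 1) (n + 1)
      * psum₂ (fun i => ρ (i + 1)) k)
      ≤ 4 * har n ^ 2 * (1 / √((n : ℝ) + 1)) * (1 / ((k : ℝ) + 1)) := fun k hk => by
    have e1 := (seminorm_connector_le hd hρ k n).trans (one_div_le_one_div_sqrt n)
    have e2 : N (psum₂ (fun i => ρ (i + 1)) k) ≤ 4 * har n ^ 2 := by
      refine (seminorm_psum₂_le N hf k).trans ?_
      have := har_mono (mem_range.1 hk).le
      have := one_le_har k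
      gcongr
    refine (map_mul_le_mul N _ _).trans ((mul_le_mul ((map_mul_le_mul N _ _).trans
      (mul_le_mul (hu k) e1 (apply_nonneg N _) (by positivity))) e2 (apply_nonneg N _)
      (by positivity)).trans_eq (by ring))
  have h2 : ∀ m ∈ range n, N (connector d ρ (n + 1) (m + 1)
      * (u m ^ 3 + u m ^ 2 * psum (fun i => ρ (i + 1)) n
        + u m * psum₂ (fun i => ρ (i + 1)) n))
      ≤ 14 * har n ^ 2 * (1 / √((n : ℝ) + 1)) * (1 / ((m : ℝ) + 1)) := fun m _ => by
    have e1 := seminorm_psum_le N hf n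
    have e2 := seminorm_psum₂_le N hf n
    have e3 : N (u m ^ 2) ≤ 1 := by
      rw [pow_two]
      exact (map_mul_le_mul N _ _).trans (mul_le_one₀ (hu1 m) (apply_nonneg N _) (hu1 m))
    have e4 : N (u m ^ 3) ≤ 1 := by
      rw [pow_succ]
      exact (map_mul_le_mul N _ _).trans (mul_le_one₀ e3 (apply_nonneg N _) (hu1 m))
    have e5 : N (u m ^ 2 * psum (fun i => ρ (i + 1)) n) ≤ 1 * (2 * har n) :=
      (map_mul_le_mul N _ _).trans (mul_le_mul e3 e1 (apply_nonneg N _) zero_le_one)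
    have e6 : N (u m * psum₂ (fun i => ρ (i + 1)) n) ≤ 1 * (4 * har n ^ 2) :=
      (map_mul_le_mul N _ _).trans (mul_le_mul (hu1 m) e2 (apply_nonneg N _) zero_le_one)
    have e7 : N (u m ^ 3 + u m ^ 2 * psum (fun i => ρ (i + 1)) n
        + u m * psum₂ (fun i => ρ (i + 1)) n) ≤ 7 * har n ^ 2 := by
      refine (map_add_le_add N _ _).trans
        ((add_le_add ((map_add_le_add N _ _).trans (add_le_add e4 e5)) e6).trans ?_)
      nlinarith
    exact (map_mul_le_mul N _ _).trans ((mul_le_mul (seminorm_connector_le_sqrt hd hρ n m) e7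
      (apply_nonneg N _) (by positivity)).trans_eq (by ring))
  have h3 := sum_one_div_le_har n
  refine (map_sub_le_add N _ _).trans ((add_le_add
    ((N.sum_le _ _).trans (sum_le_sum h1)) ((N.sum_le _ _).trans (sum_le_sum h2))).trans ?_)
  rw [← mul_sum, ← mul_sum]
  calc _ = 18 * har n ^ 2 * (1 / √((n : ℝ) + 1)) * ∑ i ∈ range n, 1 / ((i : ℝ) + 1) := by ring
    _ ≤ 18 * har n ^ 2 * (1 / √((n : ℝ) + 1)) * har n := by gcongr
    _ = _ := by ring

end Connector

end Estimates

section Series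

open PowerSeries

/-- The weighted `ℓ¹` seminorm on the coefficients of degree at most `L`. -/
noncomputable def coeffSeminorm (w : ℝ) (hw : 0 ≤ w) (L : ℕ) : RingSeminorm ℂ⟦X⟧ where
  toFun f := ∑ k ∈ range (L + 1), ‖coeff k f‖ * w ^ k
  map_zero' := by simp
  neg' f := by simp
  add_le' f g := by
    rw [← sum_add_distrib]
    refine sum_le_sum fun k _ => ?_
    rw [← add_mul, map_add]
    exact mul_le_mul_of_nonneg_right (norm_add_le _ _) (by positivity)
  mul_le' f g := by
    calc ∑ k ∈ range (L + 1), ‖coeff k (f * g)‖ * w ^ k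
        ≤ ∑ k ∈ range (L + 1), ∑ p ∈ antidiagonal k,
          (‖coeff p.1 f‖ * w ^ p.1) * (‖coeff p.2 g‖ * w ^ p.2) := by
          refine sum_le_sum fun k _ => ?_
          rw [coeff_mul]
          refine (mul_le_mul_of_nonneg_right (norm_sum_le _ _) (by positivity)).trans_eq ?_
          rw [sum_mul]
          refine sum_congr rfl fun p hp => ?_
          rw [← HasAntidiagonal.mem_antidiagonal.1 hp, norm_mul, pow_add]
          ring
      _ = ∑ p ∈ (range (L + 1)).sigma antidiagonal,
          (‖coeff p.2.1 f‖ * w ^ p.2.1) * (‖coeff p.2.2 g‖ * w ^ p.2.2) := by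
          rw [sum_sigma]
      _ = ∑ p ∈ ((range (L + 1)).sigma antidiagonal).image Sigma.snd,
          (‖coeff p.1 f‖ * w ^ p.1) * (‖coeff p.2 g‖ * w ^ p.2) := by
          rw [sum_image]
          rintro ⟨a, p⟩ ha ⟨b, q⟩ hb h
          simp only [coe_sigma, Set.mem_sigma_iff, mem_coe, HasAntidiagonal.mem_antidiagonal] at ha hb
          obtain rfl : p = q := h
          obtain rfl : a = b := ha.2.symm.trans hb.2
          rfl
      _ ≤ ∑ p ∈ range (L + 1) ×ˢ range (L + 1),
          (‖coeff p.1 f‖ * w ^ p.1) * (‖coeff p.2 g‖ * w ^ p.2) := by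
          refine sum_le_sum_of_subset_of_nonneg ?_ fun _ _ _ => by positivity
          intro p hp
          simp only [mem_image, mem_sigma, mem_range, HasAntidiagonal.mem_antidiagonal,
            mem_product] at hp ⊢
          obtain ⟨⟨a, q⟩, ⟨h1, h2⟩, rfl⟩ := hp
          simp only at h1 h2 ⊢
          omega
      _ = _ := by rw [sum_mul_sum, sum_product]

variable {w : ℝ} {hw : 0 ≤ w} {L : ℕ}

lemma coeffSeminorm_apply (f : ℂ⟦X⟧) :
    coeffSeminorm w hw L f = ∑ k ∈ range (L + 1), ‖coeff k f‖ * w ^ k := rfl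

lemma coeffSeminorm_C_mul_X_pow_le (c : ℂ) (j : ℕ) :
    coeffSeminorm w hw L (C c * X ^ j) ≤ ‖c‖ * w ^ j := by
  rw [coeffSeminorm_apply]
  have : ∀ k ∈ range (L + 1), ‖coeff k (C c * X ^ j)‖ * w ^ k
      = if k = j then ‖c‖ * w ^ j else 0 := fun k _ => by
    rw [coeff_C_mul, coeff_X_pow]
    split_ifs with h
    · rw [mul_one, h]
    · simp
  rw [sum_congr rfl this, sum_ite_eq']
  split_ifs
  · rfl
  · positivity

lemma tendsto_coeff_of_seminorm (hw' : 0 < w) {f : ℕ → ℂ⟦X⟧}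
    (h : Tendsto (fun n => coeffSeminorm w hw L (f n)) atTop (𝓝 0)) :
    Tendsto (fun n => coeff L (f n)) atTop (𝓝 0) := by
  refine squeeze_zero_norm (a := fun n => coeffSeminorm w hw L (f n) * (w ^ L)⁻¹) (fun n => ?_)
    (by simpa using h.mul_const _)
  rw [← div_eq_mul_inv, le_div_iff₀ (by positivity), coeffSeminorm_apply]
  exact single_le_sum (f := fun k => ‖coeff k (f n)‖ * w ^ k) (fun _ _ => by positivity)
    (mem_range.2 L.lt_succ_self)

/-- The expansion of `1 / (n - z * X)`. -/
noncomputable def geom (z : ℂ) (n : ℕ) : ℂ⟦X⟧ := PowerSeries.mk fun k => z ^ k / (n : ℂ) ^ (k + 1)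

/-- The linear polynomial `n - z * X`. -/
noncomputable def linSeries (z : ℂ) (n : ℕ) : ℂ⟦X⟧ := (n : ℂ⟦X⟧) - C z * X

lemma coeff_geom (z : ℂ) (n k : ℕ) : coeff k (geom z n) = z ^ k / (n : ℂ) ^ (k + 1) :=
  coeff_mk _ _

lemma linSeries_add (z : ℂ) (i j : ℕ) : linSeries z (i + j) = linSeries z i + j := by
  simp only [linSeries, Nat.cast_add]
  ring

lemma natCast_mul_geom (z : ℂ) (n : ℕ) :
    ((n + 1 : ℕ) : ℂ⟦X⟧) * geom z (n + 1) = 1 + C z * X * geom z (n + 1) := by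
  have h : ((n + 1 : ℕ) : ℂ) ≠ 0 := Nat.cast_ne_zero.2 n.succ_ne_zero
  rw [show ((n + 1 : ℕ) : ℂ⟦X⟧) = C ((n + 1 : ℕ) : ℂ) by simp, mul_assoc]
  ext k
  rcases k with _ | k
  · rw [coeff_C_mul, coeff_geom, map_add, coeff_C_mul, coeff_zero_X_mul]
    simp only [pow_zero, zero_add, pow_one, coeff_zero_one, mul_zero, add_zero]
    field_simp
  · rw [coeff_C_mul, coeff_geom, map_add, coeff_C_mul, coeff_succ_X_mul, coeff_geom,
      coeff_one, if_neg k.succ_ne_zero]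
    field_simp
    ring

lemma linSeries_mul_geom (z : ℂ) (n : ℕ) : linSeries z (n + 1) * geom z (n + 1) = 1 := by
  rw [linSeries]
  linear_combination natCast_mul_geom z n

lemma geom_mul_geom (x y : ℂ) (i j : ℕ) :
    geom x (i + 1) * geom y (j + 1)
      = geom (x + y) (i + j + 1 + 1) * (geom x (i + 1) + geom y (j + 1)) := by
  have h1 := linSeries_mul_geom x i
  have h2 := linSeries_mul_geom y j
  have h3 := linSeries_mul_geom (x + y) (i + j + 1)
  have h4 : linSeries (x + y) (i + j + 1 + 1) = linSeries x (i + 1) + linSeries y (j + 1) := by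
    simp only [linSeries, map_add]
    push_cast
    ring
  rw [h4] at h3
  linear_combination (-(geom x (i + 1) * geom y (j + 1))) * h3
    + geom (x + y) (i + j + 1 + 1) * (geom y (j + 1) * h1 + geom x (i + 1) * h2)

lemma geom_zero (n : ℕ) : geom 0 (n + 1) = C (((n : ℂ) + 1)⁻¹) := by
  ext k
  rw [coeff_geom, coeff_C]
  rcases k with _ | k <;> simp

lemma geom_zero_mul_geom_zero (i j : ℕ) :
    geom 0 (i + 1) * geom 0 (j + 1)
      = geom 0 (i + j + 1 + 1) * (geom 0 (i + 1) + geom 0 (j + 1)) := by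
  simpa using geom_mul_geom 0 0 i j

lemma natCast_mul_geom_zero (n : ℕ) : ((n + 1 : ℕ) : ℂ⟦X⟧) * geom 0 (n + 1) = 1 := by
  simpa using natCast_mul_geom 0 n

lemma geom_sub_geom_zero (z : ℂ) (n : ℕ) :
    geom z (n + 1) - geom 0 (n + 1) = geom 0 (n + 1) * (C z * X ^ 1) * geom z (n + 1) := by
  linear_combination geom 0 (n + 1) * natCast_mul_geom z n
    - geom z (n + 1) * natCast_mul_geom_zero n

lemma norm_nat_add_one (n : ℕ) : ‖((n : ℂ) + 1)‖ = (n : ℝ) + 1 := by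
  exact_mod_cast Complex.norm_natCast (n + 1)

lemma seminorm_geom_zero_le (n : ℕ) :
    coeffSeminorm w hw L (geom 0 (n + 1)) ≤ 1 / ((n : ℝ) + 1) := by
  have h := coeffSeminorm_C_mul_X_pow_le (w := w) (hw := hw) (L := L) (((n : ℂ) + 1)⁻¹) 0
  rw [pow_zero, mul_one, pow_zero, mul_one, norm_inv, norm_nat_add_one, ← one_div ((n : ℝ) + 1)] at h
  rwa [geom_zero]

lemma seminorm_linSeries_le {z : ℂ} (hz : ‖z‖ * w ≤ 1 / 4) (n : ℕ) :
    coeffSeminorm w hw L (linSeries z n) ≤ (n : ℝ) + 1 / 4 := by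
  have h1 := coeffSeminorm_C_mul_X_pow_le (w := w) (hw := hw) (L := L) (n : ℂ) 0
  have h2 := coeffSeminorm_C_mul_X_pow_le (w := w) (hw := hw) (L := L) z 1
  rw [pow_zero, mul_one, pow_zero, mul_one, Complex.norm_natCast] at h1
  rw [pow_one, pow_one] at h2
  rw [linSeries, show (n : ℂ⟦X⟧) = C (n : ℂ) by simp]
  exact (map_sub_le_add _ _ _).trans (add_le_add h1 (h2.trans hz))

lemma seminorm_geom_le {z : ℂ} (hz : ‖z‖ * w ≤ 1 / 4) (n : ℕ) :
    coeffSeminorm w hw L (geom z (n + 1)) ≤ 1 / ((n : ℝ) + 3 / 4) := by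
  rw [coeffSeminorm_apply]
  have hn : (0 : ℝ) < (n : ℝ) + 1 := by positivity
  have hq0 : (0 : ℝ) ≤ 1 / 4 / ((n : ℝ) + 1) := by positivity
  have hq1 : 1 / 4 / ((n : ℝ) + 1) < 1 := by
    rw [div_lt_one hn]
    have : (0 : ℝ) ≤ n := by positivity
    linarith
  have h : ∀ k ∈ range (L + 1), ‖coeff k (geom z (n + 1))‖ * w ^ k
      ≤ 1 / ((n : ℝ) + 1) * (1 / 4 / ((n : ℝ) + 1)) ^ k := fun k _ => by
    rw [coeff_geom, norm_div, norm_pow, norm_pow, Nat.cast_succ, norm_nat_add_one, div_pow,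
      pow_succ, div_mul_eq_mul_div, ← mul_pow, div_mul_div_comm, one_mul,
      mul_comm ((n : ℝ) + 1)]
    gcongr
  refine (sum_le_sum h).trans ?_
  rw [← mul_sum]
  have hs := (summable_geometric_of_lt_one hq0 hq1).sum_le_tsum (range (L + 1))
    fun _ _ => by positivity
  rw [tsum_geometric_of_lt_one hq0 hq1] at hs
  refine (mul_le_mul_of_nonneg_left hs (by positivity)).trans_eq ?_
  have h1 : (1 - 1 / 4 / ((n : ℝ) + 1)) = ((n : ℝ) + 3 / 4) / ((n : ℝ) + 1) := by
    field_simp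
    ring
  rw [h1, inv_div]
  field_simp

lemma seminorm_geom_le_two {z : ℂ} (hz : ‖z‖ * w ≤ 1 / 4) (n : ℕ) :
    coeffSeminorm w hw L (geom z (n + 1)) ≤ 2 / ((n : ℝ) + 1) := by
  refine (seminorm_geom_le hz n).trans ?_
  rw [div_le_div_iff₀ (by positivity) (by positivity)]
  have : (0 : ℝ) ≤ n := by positivity
  linarith

lemma seminorm_geom_sub_le {z : ℂ} (hz : ‖z‖ * w ≤ 1 / 4) (n : ℕ) :
    coeffSeminorm w hw L (geom z (n + 1) - geom 0 (n + 1)) ≤ 2 / ((n : ℝ) + 1) ^ 2 := by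
  rw [geom_sub_geom_zero]
  have h1 := coeffSeminorm_C_mul_X_pow_le (w := w) (hw := hw) (L := L) z 1
  rw [pow_one w] at h1
  refine (map_mul_le_mul _ _ _).trans ((mul_le_mul ((map_mul_le_mul _ _ _).trans
    (mul_le_mul (seminorm_geom_zero_le n) (h1.trans hz) (apply_nonneg _ _) (by positivity)))
    (seminorm_geom_le_two hz n) (apply_nonneg _ _) (by positivity)).trans ?_)
  rw [show 1 / ((n : ℝ) + 1) * (1 / 4) * (2 / ((n : ℝ) + 1)) = 1 / 4 * (2 / ((n : ℝ) + 1) ^ 2) by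
    field_simp]
  exact mul_le_of_le_one_left (by positivity) (by norm_num)

lemma exists_weight (x y : ℂ) : ∃ w : ℝ, 0 < w ∧ ‖x‖ * w ≤ 1 / 4 ∧ ‖y‖ * w ≤ 1 / 4 := by
  refine ⟨1 / (4 * (1 + ‖x‖ + ‖y‖)), by positivity, ?_, ?_⟩ <;>
  · rw [mul_one_div, div_le_div_iff₀ (by positivity) (by norm_num)]
    linarith [norm_nonneg x, norm_nonneg y]

lemma tendsto_coeff_convRem (x y : ℂ) (n : ℕ) :
    Tendsto (fun N => coeff n (convRem (fun i => geom 0 (i + 1)) (fun i => geom x (i + 1))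
      (fun i => geom y (i + 1)) N)) atTop (𝓝 0) := by
  obtain ⟨w, hw, hx, hy⟩ := exists_weight x y
  refine tendsto_coeff_of_seminorm (hw := hw.le) hw
    (tendsto_of_le_har (fun _ => apply_nonneg _ _) fun N => seminorm_convRem_le _
      (seminorm_geom_le_two hy) (seminorm_geom_le_two (by simp)) (seminorm_geom_sub_le hx)
      (seminorm_geom_sub_le hy) N)

end Series

section Truncation

/-- The truncated zeta value `Σ_{1 ≤ m ≤ n} m ^ (-k)`. -/
noncomputable def zetaTrunc (k n : ℕ) : ℝ := ∑ i ∈ range n, (((i : ℝ) + 1) ^ k)⁻¹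

/-- The truncated double zeta value. -/
noncomputable def zetaTrunc₂ (a b n : ℕ) : ℝ :=
  ∑ i ∈ range n, (((i : ℝ) + 1) ^ a)⁻¹ * zetaTrunc b i

/-- The truncated triple zeta value. -/
noncomputable def zetaTrunc₃ (a b c n : ℕ) : ℝ :=
  ∑ i ∈ range n, (((i : ℝ) + 1) ^ a)⁻¹ * zetaTrunc₂ b c i

lemma zetaTrunc_nonneg (k n : ℕ) : 0 ≤ zetaTrunc k n := sum_nonneg fun _ _ => by positivity

lemma zetaTrunc₂_nonneg (a b n : ℕ) : 0 ≤ zetaTrunc₂ a b n :=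
  sum_nonneg fun _ _ => mul_nonneg (by positivity) (zetaTrunc_nonneg _ _)

lemma zetaTrunc₃_nonneg (a b c n : ℕ) : 0 ≤ zetaTrunc₃ a b c n :=
  sum_nonneg fun _ _ => mul_nonneg (by positivity) (zetaTrunc₂_nonneg _ _ _)

lemma tendsto_zetaTrunc {k : ℕ} (hk : 2 ≤ k) :
    Tendsto (fun n => zetaTrunc k n) atTop (𝓝 (rz k)) := by
  have hs : Summable fun n : ℕ => (((n : ℝ)) ^ k)⁻¹ := Real.summable_nat_pow_inv.2 (by omega)
  have h1 : rz k = ∑' n : ℕ, (((n + 1 : ℕ) : ℝ) ^ k)⁻¹ :=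
    tsum_pnat_eq_tsum_succ (f := fun n : ℕ => ((n : ℝ) ^ k)⁻¹)
  rw [h1]
  simpa [zetaTrunc] using ((summable_nat_add_iff 1).2 hs).hasSum.tendsto_sum_nat

/-- The decreasing positive triples indexing a triple zeta value. -/
abbrev DecTriple : Type := {m : Fin 3 → ℕ // StrictAnti m ∧ ∀ i, 0 < m i}

/-- The triple `(i + 1, j + 1, k + 1)` for `k < j < i`. -/
def DecTriple.mk (i j k : ℕ) (hj : j < i) (hk : k < j) : DecTriple :=
  ⟨![i + 1, j + 1, k + 1], by
    rw [Fin.strictAnti_iff_succ_lt, Fin.forall_fin_two]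
    simp [hj, hk], by
    simp [Fin.forall_fin_succ]⟩

/-- The decreasing positive triples bounded by `n`. -/
noncomputable def decTriples (n : ℕ) : Finset DecTriple :=
  (range n).attach.biUnion fun i => (range i.1).attach.biUnion fun j =>
    (range j.1).attach.image fun k =>
      DecTriple.mk i.1 j.1 k.1 (mem_range.1 j.2) (mem_range.1 k.2)

lemma mem_decTriples {n : ℕ} {m : DecTriple} : m ∈ decTriples n ↔ m.1 0 ≤ n := by
  simp only [decTriples, mem_biUnion, mem_image, mem_attach, true_and, Subtype.exists, mem_range]
  constructor
  · rintro ⟨i, hi, j, hj, k, hk, rfl⟩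
    simpa [DecTriple.mk] using hi
  · intro h
    have h01 : m.1 1 < m.1 0 := m.2.1 (by decide)
    have h12 : m.1 2 < m.1 1 := m.2.1 (by decide)
    have h2 := m.2.2 2
    refine ⟨m.1 0 - 1, by omega, m.1 1 - 1, by omega, m.1 2 - 1, by omega, ?_⟩
    refine Subtype.ext (funext fun i => ?_)
    fin_cases i <;> simp [DecTriple.mk] <;> omega

lemma sum_decTriples (l : Fin 3 → ℕ) (n : ℕ) :
    ∑ m ∈ decTriples n, ∏ i, ((m.1 i : ℝ) ^ (l i))⁻¹ = zetaTrunc₃ (l 0) (l 1) (l 2) n := by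
  have hinj : ∀ {i j k hj hk i' j' k' hj' hk'},
      DecTriple.mk i j k hj hk = DecTriple.mk i' j' k' hj' hk' → i = i' ∧ j = j' ∧ k = k' := by
    intro i j k hj hk i' j' k' hj' hk' h
    have h := congrArg Subtype.val h
    have h0 := congrFun h 0
    have h1 := congrFun h 1
    have h2 := congrFun h 2
    simp only [DecTriple.mk, Matrix.cons_val] at h0 h1 h2
    omega
  have hL : zetaTrunc₃ (l 0) (l 1) (l 2) n
      = ∑ p ∈ (range n).sigma fun i => (range i).sigma fun j => range j,
        (((p.1 : ℝ) + 1) ^ l 0)⁻¹ * ((((p.2.1 : ℝ) + 1) ^ l 1)⁻¹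
          * (((p.2.2 : ℝ) + 1) ^ l 2)⁻¹) := by
    rw [sum_sigma, zetaTrunc₃]
    refine sum_congr rfl fun i _ => ?_
    rw [sum_sigma, zetaTrunc₂, mul_sum]
    refine sum_congr rfl fun j _ => ?_
    rw [zetaTrunc, mul_sum, mul_sum]
  rw [hL]
  symm
  have hmem : ∀ p ∈ (range n).sigma fun i => (range i).sigma fun j => range j,
      p.1 < n ∧ p.2.1 < p.1 ∧ p.2.2 < p.2.1 := fun p hp => by
    simpa only [mem_sigma, mem_range] using hp
  refine sum_bij (fun p hp => DecTriple.mk p.1 p.2.1 p.2.2 (hmem p hp).2.1 (hmem p hp).2.2)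
    ?_ ?_ ?_ ?_
  · intro p hp
    simpa [mem_decTriples, DecTriple.mk] using (hmem p hp).1
  · rintro ⟨i, j, k⟩ _ ⟨i', j', k'⟩ _ h
    obtain ⟨rfl, rfl, rfl⟩ := hinj h
    rfl
  · intro m hm
    simp only [decTriples, mem_biUnion, mem_image, mem_attach, true_and, Subtype.exists,
      mem_range] at hm
    obtain ⟨i, hi, j, hj, k, hk, rfl⟩ := hm
    exact ⟨⟨i, j, k⟩, by simp [hi, hj, hk], rfl⟩
  · intro p hp
    simp only [DecTriple.mk, Fin.prod_univ_three, Matrix.cons_val]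
    push_cast
    ring

lemma tendsto_zetaTrunc₃ (l : Fin 3 → ℕ) {B : ℝ}
    (hB : ∀ n, zetaTrunc₃ (l 0) (l 1) (l 2) n ≤ B) :
    Tendsto (fun n => zetaTrunc₃ (l 0) (l 1) (l 2) n) atTop (𝓝 (mzv l)) := by
  have ht : Tendsto decTriples atTop atTop := tendsto_atTop_finset_of_monotone
    (fun a b hab m hm => mem_decTriples.2 ((mem_decTriples.1 hm).trans hab))
    (fun m => ⟨m.1 0, mem_decTriples.2 le_rfl⟩)
  have hs : Summable fun m : DecTriple => ∏ i, ((m.1 i : ℝ) ^ (l i))⁻¹ := by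
    refine summable_of_sum_le (c := B)
      (fun m => prod_nonneg fun i _ => by positivity) fun u => ?_
    obtain ⟨n, hn⟩ := (ht.eventually (eventually_ge_atTop u)).exists
    refine le_trans (sum_le_sum_of_subset_of_nonneg hn fun m _ _ =>
      prod_nonneg fun i _ => by positivity) ?_
    rw [sum_decTriples]
    exact hB n
  exact (hs.hasSum.comp ht).congr fun n => sum_decTriples l n

end Truncation

section Coefficients

open PowerSeries

lemma coeff_psum_geom (z : ℂ) (k n : ℕ) :
    coeff k (psum (fun i => geom z (i + 1)) n) = z ^ k * (zetaTrunc (k + 1) n : ℂ) := by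
  rw [psum, map_sum, zetaTrunc, Complex.ofReal_sum, mul_sum]
  refine sum_congr rfl fun i _ => ?_
  rw [coeff_geom]
  push_cast
  rw [div_eq_mul_inv]

lemma coeff_geom_sq (z : ℂ) (n k : ℕ) :
    coeff k (geom z n ^ 2) = ((k : ℂ) + 1) * (z ^ k / (n : ℂ) ^ (k + 2)) := by
  rw [pow_two, coeff_mul]
  have : ∀ p ∈ antidiagonal k, coeff p.1 (geom z n) * coeff p.2 (geom z n)
      = z ^ k / (n : ℂ) ^ (k + 2) := fun p hp => by
    rw [coeff_geom, coeff_geom, ← HasAntidiagonal.mem_antidiagonal.1 hp, div_mul_div_comm,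
      ← pow_add, ← pow_add]
    congr 2
    ring
  rw [sum_congr rfl this, sum_const, Nat.card_antidiagonal, nsmul_eq_mul]
  push_cast
  ring

lemma coeff_geom_cube (z : ℂ) (n k : ℕ) :
    coeff k (geom z n ^ 3)
      = ((k : ℂ) + 1) * ((k : ℂ) + 2) / 2 * (z ^ k / (n : ℂ) ^ (k + 3)) := by
  rw [pow_succ, coeff_mul]
  have : ∀ p ∈ antidiagonal k, coeff p.1 (geom z n ^ 2) * coeff p.2 (geom z n)
      = ((p.1 : ℂ) + 1) * (z ^ k / (n : ℂ) ^ (k + 3)) := fun p hp => by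
    rw [coeff_geom_sq, coeff_geom, ← HasAntidiagonal.mem_antidiagonal.1 hp, mul_assoc,
      div_mul_div_comm, ← pow_add, ← pow_add]
    congr 3
    ring
  rw [sum_congr rfl this, ← sum_mul]
  congr 1
  rw [Finset.Nat.sum_antidiagonal_eq_sum_range_succ_mk]
  induction k with
  | zero => simp
  | succ k ih =>
    rw [sum_range_succ, ih fun p hp => ?_]
    · push_cast
      ring
    · rw [coeff_geom_sq, coeff_geom, ← HasAntidiagonal.mem_antidiagonal.1 hp, mul_assoc,
        div_mul_div_comm, ← pow_add, ← pow_add]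
      congr 3
      ring

lemma coeff_psum_geom_sq (z : ℂ) (k n : ℕ) :
    coeff k (psum (fun i => geom z (i + 1) ^ 2) n)
      = ((k : ℂ) + 1) * z ^ k * (zetaTrunc (k + 2) n : ℂ) := by
  rw [psum, map_sum, zetaTrunc, Complex.ofReal_sum, mul_sum]
  refine sum_congr rfl fun i _ => ?_
  rw [coeff_geom_sq]
  push_cast
  rw [div_eq_mul_inv, mul_assoc]

lemma coeff_psum_geom_cube (z : ℂ) (k n : ℕ) :
    coeff k (psum (fun i => geom z (i + 1) ^ 3) n)
      = ((k : ℂ) + 1) * ((k : ℂ) + 2) / 2 * z ^ k * (zetaTrunc (k + 3) n : ℂ) := by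
  rw [psum, map_sum, zetaTrunc, Complex.ofReal_sum, mul_sum]
  refine sum_congr rfl fun i _ => ?_
  rw [coeff_geom_cube]
  push_cast
  ring

lemma coeff_psum₂_geom (z : ℂ) (k n : ℕ) :
    coeff k (psum₂ (fun i => geom z (i + 1)) n)
      = ∑ p ∈ antidiagonal k, z ^ k * (zetaTrunc₂ (p.1 + 1) (p.2 + 1) n : ℂ) := by
  simp_rw [psum₂, map_sum, coeff_mul, zetaTrunc₂, Complex.ofReal_sum, mul_sum]
  rw [sum_comm]
  refine sum_congr rfl fun p hp => sum_congr rfl fun i _ => ?_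
  rw [coeff_psum_geom, coeff_geom, ← HasAntidiagonal.mem_antidiagonal.1 hp]
  push_cast
  ring

lemma coeff_psum₃_geom (a z : ℂ) (k n : ℕ) :
    coeff k (psum₃ (fun i => geom a (i + 1)) (fun i => geom z (i + 1)) n)
      = ∑ p ∈ antidiagonal k, ∑ q ∈ antidiagonal p.2,
        a ^ p.1 * z ^ p.2 * (zetaTrunc₃ (p.1 + 1) (q.1 + 1) (q.2 + 1) n : ℂ) := by
  simp_rw [psum₃, map_sum, coeff_mul, zetaTrunc₃, Complex.ofReal_sum, mul_sum]
  rw [sum_comm]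
  refine sum_congr rfl fun p _ => ?_
  rw [sum_comm]
  refine sum_congr rfl fun i _ => ?_
  rw [coeff_psum₂_geom, coeff_geom, mul_sum]
  refine sum_congr rfl fun q _ => ?_
  push_cast
  ring

end Coefficients

section Limits

open PowerSeries

lemma coeff_sum_cube_mul_geom (z : ℂ) (k N : ℕ) :
    coeff (k + 1) (linSeries z 0 * ∑ m ∈ range N, geom 0 (m + 1) ^ 3 * geom z (m + 1))
      = -(z ^ (k + 1) * (zetaTrunc (k + 4) N : ℂ)) := by
  rw [linSeries, Nat.cast_zero, zero_sub, neg_mul, map_neg, mul_assoc, coeff_C_mul,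
    coeff_succ_X_mul, map_sum, zetaTrunc, Complex.ofReal_sum, mul_sum, mul_sum]
  congr 1
  refine sum_congr rfl fun m _ => ?_
  rw [geom_zero, ← map_pow, coeff_C_mul, coeff_geom]
  push_cast
  field_simp
  ring

/-- The generating function form of the sum formula of depth three. -/
lemma tendsto_coeff_psum₃_sub (z : ℂ) {n : ℕ} (hn : 1 ≤ n) :
    Tendsto (fun N => coeff n (psum₃ (fun i => geom z (i + 1)) (fun i => geom z (i + 1)) N
      - psum₃ (fun i => geom 0 (i + 1)) (fun i => geom z (i + 1)) N)) atTop
      (𝓝 (z ^ n * (rz (n + 3) : ℂ))) := by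
  obtain ⟨k, rfl⟩ : ∃ k, n = k + 1 := ⟨n - 1, by omega⟩
  obtain ⟨w, hw, hz, -⟩ := exists_weight z z
  have hrem : Tendsto (fun N =>
      coeff (k + 1) (∑ k ∈ range N, geom 0 (k + 1)
          * connector (linSeries z) (geom z) (k + 1) (N + 1) * psum₂ (fun i => geom z (i + 1)) k
        - ∑ m ∈ range N, connector (linSeries z) (geom z) (N + 1) (m + 1)
          * (geom 0 (m + 1) ^ 3 + geom 0 (m + 1) ^ 2 * psum (fun i => geom z (i + 1)) N
            + geom 0 (m + 1) * psum₂ (fun i => geom z (i + 1)) N))) atTop (𝓝 0) :=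
    tendsto_coeff_of_seminorm (hw := hw.le) hw
      (tendsto_of_le_har (fun _ => apply_nonneg _ _) fun N =>
        seminorm_sumFormula_rem_le (u := fun i => geom 0 (i + 1)) (seminorm_linSeries_le hz)
          (seminorm_geom_le hz) seminorm_geom_zero_le N)
  have hmain : Tendsto (fun N => z ^ (k + 1) * (zetaTrunc (k + 4) N : ℂ)) atTop
      (𝓝 (z ^ (k + 1) * (rz (k + 4) : ℂ))) :=
    ((Complex.continuous_ofReal.tendsto _).comp (tendsto_zetaTrunc (by omega))).const_mul _
  have h := hmain.sub hrem
  rw [sub_zero] at h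
  refine h.congr fun N => ?_
  have h1 := psum₃_sub_psum₃ (linSeries_add z) (linSeries_mul_geom z)
    (u := fun i => geom 0 (i + 1)) natCast_mul_geom_zero N
  rw [← neg_sub (psum₃ _ _ N), h1, ← neg_eq_iff_eq_neg.2 (coeff_sum_cube_mul_geom z k N),
    map_neg, map_add, map_sub, map_sub]
  ring

lemma exists_zetaTrunc₃_le {a b c : ℕ} (ha : 1 ≤ a) :
    ∃ B, ∀ n, zetaTrunc₃ (a + 1) (b + 1) (c + 1) n ≤ B := by
  have h := tendsto_coeff_psum₃_sub 1 (n := a + (b + c)) (by omega)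
  obtain ⟨B, hB⟩ := h.norm.bddAbove_range
  refine ⟨B, fun n => le_trans ?_ (hB ⟨n, rfl⟩)⟩
  have hc : coeff (a + (b + c)) (psum₃ (fun i => geom 1 (i + 1)) (fun i => geom 1 (i + 1)) n
      - psum₃ (fun i => geom 0 (i + 1)) (fun i => geom 1 (i + 1)) n)
      = ((∑ p ∈ antidiagonal (a + (b + c)), ∑ q ∈ antidiagonal p.2,
        (1 - 0 ^ p.1) * zetaTrunc₃ (p.1 + 1) (q.1 + 1) (q.2 + 1) n : ℝ) : ℂ) := by
    rw [map_sub, coeff_psum₃_geom, coeff_psum₃_geom, ← sum_sub_distrib]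
    push_cast
    refine sum_congr rfl fun p _ => ?_
    rw [← sum_sub_distrib]
    refine sum_congr rfl fun q _ => ?_
    rw [one_pow, one_pow]
    ring
  have h0 : ∀ (i : ℕ) (t : ℝ), 0 ≤ t → 0 ≤ (1 - 0 ^ i) * t := fun i t ht =>
    mul_nonneg (sub_nonneg.2 (pow_le_one₀ le_rfl zero_le_one)) ht
  simp only [hc]
  rw [Complex.norm_real]
  refine le_trans ?_ (le_abs_self _)
  refine le_trans ?_ (single_le_sum (fun p _ => sum_nonneg fun q _ =>
    h0 p.1 _ (zetaTrunc₃_nonneg _ _ _ _))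
    (HasAntidiagonal.mem_antidiagonal.2 (rfl : (a, b + c).1 + (a, b + c).2 = _)))
  refine le_trans ?_ (single_le_sum (fun q _ => h0 a _ (zetaTrunc₃_nonneg _ _ _ _))
    (HasAntidiagonal.mem_antidiagonal.2 (rfl : (b, c).1 + (b, c).2 = _)))
  rw [zero_pow (by omega), sub_zero, one_mul]

lemma tendsto_zetaTrunc₃_mzv {a b c : ℕ} (ha : 1 ≤ a) :
    Tendsto (fun n => zetaTrunc₃ (a + 1) (b + 1) (c + 1) n) atTop
      (𝓝 (mzv ![a + 1, b + 1, c + 1])) := by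
  obtain ⟨B, hB⟩ := exists_zetaTrunc₃_le (b := b) (c := c) ha
  exact tendsto_zetaTrunc₃ ![a + 1, b + 1, c + 1] hB

lemma G_three_eq (n : ℕ) (a b : ℂ) :
    G (n + 3) 3 a b = ∑ p ∈ antidiagonal n, ∑ q ∈ antidiagonal p.2,
      (a ^ p.1 - 0 ^ p.1) * b ^ p.2 * (mzv ![p.1 + 1, q.1 + 1, q.2 + 1] : ℂ) := by
  have hsub : ∀ i : ℕ, 1 ≤ i → a ^ i - 0 ^ i = a ^ i := fun i hi => by
    rw [zero_pow (by omega), sub_zero]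
  rw [sum_sigma', ← sum_filter_of_ne (p := fun s => 1 ≤ s.1.1)]
  · symm
    refine sum_bij (fun s _ => ![s.1.1 + 1, s.2.1 + 1, s.2.2 + 1]) ?_ ?_ ?_ ?_
    · rintro ⟨⟨i, m⟩, ⟨j, k⟩⟩ hs
      simp only [mem_filter, mem_sigma, HasAntidiagonal.mem_antidiagonal] at hs
      have e := Fin.sum_univ_three ![i + 1, j + 1, k + 1]
      simp only [Matrix.cons_val] at e
      simp only [mem_filter, Finset.Nat.mem_antidiagonalTuple]
      refine ⟨e.trans (by omega), by simpa using hs.2, fun t => ?_⟩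
      fin_cases t <;> simp
    · rintro ⟨⟨i, m⟩, ⟨j, k⟩⟩ hs ⟨⟨i', m'⟩, ⟨j', k'⟩⟩ hs' h
      simp only [mem_filter, mem_sigma, HasAntidiagonal.mem_antidiagonal] at hs hs'
      have h0 := congrFun h 0
      have h1 := congrFun h 1
      have h2 := congrFun h 2
      simp only [Matrix.cons_val] at h0 h1 h2
      obtain rfl : i = i' := by omega
      obtain rfl : j = j' := by omega
      obtain rfl : k = k' := by omega
      obtain rfl : m = m' := by omega
      rfl
    · intro c hc
      simp only [mem_filter, Finset.Nat.mem_antidiagonalTuple] at hc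
      have e := (Fin.sum_univ_three c).symm.trans hc.1
      have h1 := hc.2.2 1
      have h2 := hc.2.2 2
      refine ⟨⟨(c 0 - 1, c 1 + c 2 - 2), (c 1 - 1, c 2 - 1)⟩, ?_, ?_⟩
      · simp only [mem_filter, mem_sigma, HasAntidiagonal.mem_antidiagonal]
        omega
      · funext i
        fin_cases i <;> simp <;> omega
    · rintro ⟨⟨i, m⟩, ⟨j, k⟩⟩ hs
      simp only [mem_filter, mem_sigma, HasAntidiagonal.mem_antidiagonal] at hs
      simp only [Matrix.cons_val, hsub i hs.2]
      rw [show i + 1 - 1 = i by omega, show n + 3 - (i + 1) - 2 = m by omega]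
  · rintro ⟨⟨i, m⟩, ⟨j, k⟩⟩ _ h
    by_contra h0
    obtain rfl : i = 0 := by simpa using h0
    simp at h

/-- The weighted sum as a limit of coefficients of nested partial sums. -/
lemma tendsto_coeff_G (a b : ℂ) (n : ℕ) :
    Tendsto (fun N => coeff n (psum₃ (fun i => geom a (i + 1)) (fun i => geom b (i + 1)) N
      - psum₃ (fun i => geom 0 (i + 1)) (fun i => geom b (i + 1)) N)) atTop
      (𝓝 (G (n + 3) 3 a b)) := by
  rw [G_three_eq]
  have hc : ∀ N, coeff n (psum₃ (fun i => geom a (i + 1)) (fun i => geom b (i + 1)) N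
      - psum₃ (fun i => geom 0 (i + 1)) (fun i => geom b (i + 1)) N)
      = ∑ p ∈ antidiagonal n, ∑ q ∈ antidiagonal p.2, (a ^ p.1 - 0 ^ p.1) * b ^ p.2
        * (zetaTrunc₃ (p.1 + 1) (q.1 + 1) (q.2 + 1) N : ℂ) := fun N => by
    rw [map_sub, coeff_psum₃_geom, coeff_psum₃_geom, ← sum_sub_distrib]
    refine sum_congr rfl fun p _ => ?_
    rw [← sum_sub_distrib]
    refine sum_congr rfl fun q _ => ?_
    ring
  simp only [hc]
  refine tendsto_finsetSum _ fun p _ => tendsto_finsetSum _ fun q _ => ?_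
  rcases Nat.eq_zero_or_pos p.1 with h | h
  · simp [h]
  · exact ((Complex.continuous_ofReal.tendsto _).comp (tendsto_zetaTrunc₃_mzv h)).const_mul _

end Limits

section Identity

open PowerSeries

/-- The generating function of `(x ^ k - y ^ k) * ζ(k + 1)`. -/
noncomputable def zetaDiff (x y : ℂ) : ℂ⟦X⟧ :=
  PowerSeries.mk fun k => (x ^ k - y ^ k) * (rz (k + 1) : ℂ)

/-- The generating function of `(k + 1) * (x ^ k + y ^ k) * ζ(k + 2)`. -/
noncomputable def zetaSq (x y : ℂ) : ℂ⟦X⟧ :=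
  PowerSeries.mk fun k => ((k : ℂ) + 1) * (x ^ k + y ^ k) * (rz (k + 2) : ℂ)

/-- The generating function of `(k + 1) * (k + 2) / 2 * (x ^ k - y ^ k) * ζ(k + 3)`. -/
noncomputable def zetaCube (x y : ℂ) : ℂ⟦X⟧ :=
  PowerSeries.mk fun k => ((k : ℂ) + 1) * ((k : ℂ) + 2) / 2 * (x ^ k - y ^ k) * (rz (k + 3) : ℂ)

lemma tendsto_ofReal_zetaTrunc {k : ℕ} (hk : 2 ≤ k) :
    Tendsto (fun n => (zetaTrunc k n : ℂ)) atTop (𝓝 (rz k : ℂ)) :=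
  (Complex.continuous_ofReal.tendsto _).comp (tendsto_zetaTrunc hk)

open scoped PowerSeries.WithPiTopology

lemma tendsto_psum_geom_sub (x y : ℂ) :
    Tendsto (fun N => psum (fun i => geom x (i + 1)) N - psum (fun i => geom y (i + 1)) N) atTop
      (𝓝 (zetaDiff x y)) := by
  refine (WithPiTopology.tendsto_iff_coeff_tendsto _ _ _ _).2 fun k => ?_
  simp only [zetaDiff, coeff_mk, map_sub, coeff_psum_geom, ← sub_mul]
  rcases Nat.eq_zero_or_pos k with rfl | hk
  · simp
  · exact (tendsto_ofReal_zetaTrunc (by omega)).const_mul _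

lemma tendsto_psum_geom_sq_add (x y : ℂ) :
    Tendsto (fun N => psum (fun i => geom x (i + 1) ^ 2) N
      + psum (fun i => geom y (i + 1) ^ 2) N) atTop (𝓝 (zetaSq x y)) := by
  refine (WithPiTopology.tendsto_iff_coeff_tendsto _ _ _ _).2 fun k => ?_
  simp only [zetaSq, coeff_mk, map_add, coeff_psum_geom_sq, ← add_mul, ← mul_add]
  exact (tendsto_ofReal_zetaTrunc (by omega)).const_mul _

lemma tendsto_psum_geom_cube_sub (x y : ℂ) :
    Tendsto (fun N => psum (fun i => geom x (i + 1) ^ 3) N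
      - psum (fun i => geom y (i + 1) ^ 3) N) atTop (𝓝 (zetaCube x y)) := by
  refine (WithPiTopology.tendsto_iff_coeff_tendsto _ _ _ _).2 fun k => ?_
  simp only [zetaCube, coeff_mk, map_sub, coeff_psum_geom_cube, ← sub_mul, ← mul_sub]
  exact (tendsto_ofReal_zetaTrunc (by omega)).const_mul _

lemma tendsto_psum_geom_zero_sq :
    Tendsto (fun N => psum (fun i => geom 0 (i + 1) ^ 2) N) atTop (𝓝 (C (rz 2 : ℂ))) := by
  refine (WithPiTopology.tendsto_iff_coeff_tendsto _ _ _ _).2 fun k => ?_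
  simp only [coeff_psum_geom_sq, coeff_C]
  rcases k with _ | k
  · simpa using tendsto_ofReal_zetaTrunc le_rfl
  · simp

lemma six_mul_psum₃_sub_sub (x y : ℂ) (N : ℕ) :
    let f : ℕ → ℂ⟦X⟧ := fun i => geom x (i + 1)
    let g : ℕ → ℂ⟦X⟧ := fun i => geom y (i + 1)
    let s : ℕ → ℂ⟦X⟧ := fun i => geom (x + y) (i + 1)
    let u : ℕ → ℂ⟦X⟧ := fun i => geom 0 (i + 1)
    6 * ((psum₃ s g N - psum₃ u g N) - (psum₃ s f N - psum₃ u f N))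
      = (psum f N - psum g N) ^ 3
        - 3 * ((psum f N - psum g N)
          * (psum (fun i => f i ^ 2) N + psum (fun i => g i ^ 2) N))
        + 2 * (psum (fun i => f i ^ 3) N - psum (fun i => g i ^ 3) N)
        + 6 * (psum (fun i => u i ^ 2) N * (psum f N - psum g N))
        + 6 * ((psum₃ g g N - psum₃ u g N) - (psum₃ f f N - psum₃ u f N)
          - (convRem u f g N - convRem u g f N)) := by
  intro f g s u
  have h1 := psum_mul_psum₂_sub f g N
  have h2 := conv₂_sub_conv₂ (f := f) (g := g) (s := s) (geom_mul_geom x y) N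
  have h3 := conv₂_sub_conv₂_eq (u := u) geom_zero_mul_geom_zero f g N
  linear_combination h1 - 6 * h2 + 6 * h3

lemma six_mul_G_sub_G (x y : ℂ) {n : ℕ} (hn : 1 ≤ n) :
    6 * (G (n + 3) 3 (x + y) y - G (n + 3) 3 (x + y) x)
      = coeff n (zetaDiff x y ^ 3) - 3 * coeff n (zetaDiff x y * zetaSq x y)
        + 2 * coeff n (zetaCube x y) + 6 * coeff n (C (rz 2 : ℂ) * zetaDiff x y)
        + 6 * ((y ^ n - x ^ n) * (rz (n + 3) : ℂ)) := by
  have hA := tendsto_psum_geom_sub x y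
  have hcoeff : Continuous fun p : ℂ⟦X⟧ => coeff n p := WithPiTopology.continuous_coeff ℂ n
  have h1 := ((hcoeff.tendsto _).comp (hA.pow 3)).sub
    (((hcoeff.tendsto _).comp (hA.mul (tendsto_psum_geom_sq_add x y))).const_mul 3)
  have h2 := ((hcoeff.tendsto _).comp (tendsto_psum_geom_cube_sub x y)).const_mul 2
  have h3 := ((hcoeff.tendsto _).comp (tendsto_psum_geom_zero_sq.mul hA)).const_mul 6
  have h4 := (((tendsto_coeff_psum₃_sub y hn).sub (tendsto_coeff_psum₃_sub x hn)).sub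
    ((tendsto_coeff_convRem x y n).sub (tendsto_coeff_convRem y x n))).const_mul 6
  have h5 := ((tendsto_coeff_G (x + y) y n).sub (tendsto_coeff_G (x + y) x n)).const_mul 6
  rw [sub_zero, sub_zero, ← sub_mul] at h4
  refine tendsto_nhds_unique h5 ((((h1.add h2).add h3).add h4).congr fun N => ?_)
  have h := congrArg (coeff n) (six_mul_psum₃_sub_sub x y N)
  have hk : ∀ (k : ℕ) (p : ℂ⟦X⟧), coeff n ((k : ℂ⟦X⟧) * p) = k * coeff n p := fun k p => by
    rw [show (k : ℂ⟦X⟧) = C (k : ℂ) by simp, coeff_C_mul]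
  have hk2 := hk 2
  have hk3 := hk 3
  have hk6 := hk 6
  push_cast at hk2 hk3 hk6
  simp only [map_add, map_sub, hk2, hk3, hk6] at h
  simp only [map_sub, Function.comp_apply]
  exact h.symm

lemma sum_Icc_two_eq (F : ℕ → ℂ) (hF : F 1 = 0) (n : ℕ) :
    ∑ j ∈ Icc 2 n, F j = ∑ a ∈ range n, F (a + 1) := by
  rcases n with _ | n
  · simp
  · rw [sum_range_succ', hF, add_zero, range_eq_Ico, sum_Ico_add' F 0 n 2]
    rfl

lemma coeff_zetaDiff_zero (x y : ℂ) : coeff 0 (zetaDiff x y) = 0 := by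
  simp [zetaDiff]

lemma coeff_zetaDiff_mul_zetaSq (x y : ℂ) (n : ℕ) :
    coeff n (zetaDiff x y * zetaSq x y)
      = ∑ j ∈ Icc 2 n, ((n : ℂ) + 2 - j) * (x ^ (j - 1) - y ^ (j - 1))
          * (x ^ (n + 1 - j) + y ^ (n + 1 - j)) * (rz j : ℂ) * (rz (n + 3 - j) : ℂ)
        + 2 * coeff n (C (rz 2 : ℂ) * zetaDiff x y) := by
  rw [sum_Icc_two_eq _ (by simp), coeff_mul, Finset.Nat.sum_antidiagonal_eq_sum_range_succ_mk,
    sum_range_succ]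
  congr 1
  · refine sum_congr rfl fun a ha => ?_
    have ha := mem_range.1 ha
    rw [zetaDiff, zetaSq, coeff_mk, coeff_mk, Nat.cast_sub ha.le,
      show n + 1 - (a + 1) = n - a by omega, show n + 3 - (a + 1) = n - a + 2 by omega]
    push_cast
    ring
  · rw [coeff_C_mul]
    simp [zetaSq]
    ring

lemma coeff_zetaDiff_cube (x y : ℂ) {n : ℕ} (hn : 1 ≤ n) :
    coeff n (zetaDiff x y ^ 3)
      = ∑ i ∈ Icc 2 (n - 1), ∑ j ∈ Icc 2 (n + 1 - i),
          (x ^ (i - 1) - y ^ (i - 1)) * (x ^ (j - 1) - y ^ (j - 1))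
            * (x ^ (n + 2 - i - j) - y ^ (n + 2 - i - j))
            * (rz i : ℂ) * (rz j : ℂ) * (rz (n + 3 - i - j) : ℂ) := by
  obtain ⟨m, rfl⟩ : ∃ m, n = m + 1 := ⟨n - 1, by omega⟩
  have h0 := coeff_zetaDiff_zero x y
  have hc : ∀ k, coeff k (zetaDiff x y) = (x ^ k - y ^ k) * (rz (k + 1) : ℂ) := fun k =>
    coeff_mk _ _
  have h2 : ∀ k, coeff k (zetaDiff x y * zetaDiff x y)
      = ∑ b ∈ range k, coeff b (zetaDiff x y) * coeff (k - b) (zetaDiff x y) := fun k => by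
    rw [coeff_mul, Finset.Nat.sum_antidiagonal_eq_sum_range_succ_mk, sum_range_succ]
    simp [h0]
  have h20 : coeff 0 (zetaDiff x y * zetaDiff x y) = 0 := by simp [h2]
  have h21 : coeff 1 (zetaDiff x y * zetaDiff x y) = 0 := by simp [h2, h0]
  rw [sum_Icc_two_eq _ (by simp), pow_succ', pow_two, coeff_mul,
    Finset.Nat.sum_antidiagonal_eq_sum_range_succ_mk, sum_range_succ, sum_range_succ,
    Nat.sub_self, h20, Nat.add_sub_cancel_left, h21, mul_zero, mul_zero, add_zero, add_zero,
    Nat.add_sub_cancel]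
  refine sum_congr rfl fun a ha => ?_
  have ha := mem_range.1 ha
  rw [sum_Icc_two_eq _ (by simp), h2, mul_sum, show m + 1 + 1 - (a + 1) = m + 1 - a by omega]
  refine sum_congr rfl fun b hb => ?_
  have hb := mem_range.1 hb
  rw [hc, hc, hc, Nat.add_sub_cancel, Nat.add_sub_cancel,
    show m + 1 + 2 - (a + 1) - (b + 1) = m + 1 - a - b by omega,
    show m + 1 + 3 - (a + 1) - (b + 1) = m + 1 - a - b + 1 by omega]
  ring

end Identity

end

/-- Proposition 4.1 (ii) of Machide: for `l ≥ 4`,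
`G_l^3(x+y,y) - G_l^3(y+x,x)
  = ((l+1)(l-4)/6)(x^(l-3) - y^(l-3)) ζ(l)
    - (1/2) Σ_{j₁≥2, j₂≥3, j₁+j₂=l} (j₂-1)(x^(j₁-1)-y^(j₁-1))(x^(j₂-2)+y^(j₂-2)) ζ(j₁)ζ(j₂)
    + (1/6) Σ_{j₁,j₂,j₃≥2, j₁+j₂+j₃=l} Π_i (x^(jᵢ-1)-y^(jᵢ-1)) ζ(jᵢ)`,
where in the double sum `j₂ = l - j₁` and in the triple sum `j₃ = l - j₁ - j₂`. -/
theorem depth_three_identity (l : ℕ) (hl : 4 ≤ l) (x y : ℂ) :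
    G l 3 (x + y) y - G l 3 (y + x) x
      = ((l : ℂ) + 1) * ((l : ℂ) - 4) / 6 * (x ^ (l - 3) - y ^ (l - 3)) * (rz l : ℂ)
        - (1 / 2) * (∑ j ∈ Finset.Icc 2 (l - 3),
            ((l : ℂ) - (j : ℂ) - 1) * (x ^ (j - 1) - y ^ (j - 1))
              * (x ^ (l - j - 2) + y ^ (l - j - 2)) * (rz j : ℂ) * (rz (l - j) : ℂ))
        + (1 / 6) * (∑ j₁ ∈ Finset.Icc 2 (l - 4), ∑ j₂ ∈ Finset.Icc 2 (l - j₁ - 2),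
            (x ^ (j₁ - 1) - y ^ (j₁ - 1)) * (x ^ (j₂ - 1) - y ^ (j₂ - 1))
              * (x ^ (l - j₁ - j₂ - 1) - y ^ (l - j₁ - j₂ - 1))
              * (rz j₁ : ℂ) * (rz j₂ : ℂ) * (rz (l - j₁ - j₂) : ℂ)) := by
  obtain ⟨n, rfl⟩ : ∃ n, l = n + 3 := ⟨l - 3, by omega⟩
  have hn : 1 ≤ n := by omega
  have h := six_mul_G_sub_G x y hn
  rw [coeff_zetaDiff_mul_zetaSq, coeff_zetaDiff_cube x y hn, zetaCube,
    PowerSeries.coeff_mk] at h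
  rw [add_comm y x, show n + 3 - 4 = n - 1 by omega, Nat.add_sub_cancel]
  have e1 : ∀ j, n + 3 - j - 2 = n + 1 - j := fun j => by omega
  have e2 : ∀ i j, n + 3 - i - j - 1 = n + 2 - i - j := fun i j => by omega
  have e3 : ∀ j : ℕ, ((n + 3 : ℕ) : ℂ) - j - 1 = (n : ℂ) + 2 - j := fun j => by
    push_cast
    ring
  simp only [e1, e2, e3]
  push_cast
  linear_combination h / 6
end
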